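/- Let n ≥ 2, and let A and Ā be constant positive definite n×n real matrices. Suppose u and v are smooth functions on ℝⁿ with div(A∇u) = 0 and div(Ā∇v) = 0 on all of ℝⁿ, v is not identically zero, Z(v) ⊆ Z(u), and u is a not identically zero polynomial function. Then v is a polynomial function. -/

import Mathlib

open MeasureTheory Metric

noncomputable section

/-- Partial derivative in the `i`-th coordinate direction. -/
def pd {n : ℕ} (i : Fin n) (u : EuclideanSpace ℝ (Fin n) → ℝ) :
    EuclideanSpace ℝ (Fin n) → ℝ :=
  fun x => fderiv ℝ u x (EuclideanSpace.single i 1)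

section

open Polynomial Filter Topology

/-- An entire function of polynomial growth is a polynomial. -/
theorem exists_polynomial_of_entire_of_growth {H : ℂ → ℂ} (hH : Differentiable ℂ H) {C : ℝ} {N : ℕ}
    (hb : ∀ z, ‖H z‖ ≤ C * (1 + ‖z‖) ^ N) :
    ∃ q : ℂ[X], q.natDegree ≤ N ∧ ∀ z, H z = q.eval z := by
  have hC : 0 ≤ C := by simpa using (norm_nonneg _).trans (hb 0)
  have hzero : ∀ k, N < k → iteratedDeriv k H 0 = 0 := by
    intro k hk
    have hle : ∀ R : ℝ, 1 ≤ R → ‖iteratedDeriv k H 0‖ ≤ k.factorial * (C * 2 ^ N) * R⁻¹ := by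
      intro R hR
      have hR0 : 0 < R := by linarith
      refine (Complex.norm_iteratedDeriv_le_of_forall_mem_sphere_norm_le k hR0
        hH.diffContOnCl (C := C * (2 * R) ^ N) ?_).trans ?_
      · intro z hz
        have hz' : ‖z‖ = R := by simpa using hz
        refine (hb z).trans ?_
        gcongr
        linarith
      · obtain ⟨j, rfl⟩ := Nat.exists_eq_add_of_lt hk
        have : R ^ (N + j + 1) = R ^ N * R ^ j * R := by ring
        rw [this, mul_pow, div_le_iff₀ (by positivity)]
        have h1 : (1 : ℝ) ≤ R ^ j := one_le_pow₀ hR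
        have e : (N + j + 1).factorial * (C * 2 ^ N) * R⁻¹ * (R ^ N * R ^ j * R)
          = (N + j + 1).factorial * (C * (2 ^ N * R ^ N)) * R ^ j := by field_simp
        rw [e]
        exact le_mul_of_one_le_right (by positivity) h1
    have hlim : Tendsto (fun R : ℝ => k.factorial * (C * 2 ^ N) * R⁻¹) atTop (𝓝 0) := by
      simpa using tendsto_inv_atTop_zero.const_mul ((k.factorial : ℝ) * (C * 2 ^ N))
    have := ge_of_tendsto hlim ((eventually_ge_atTop 1).mono hle)
    exact norm_le_zero_iff.1 this
  refine ⟨∑ k ∈ Finset.range (N + 1), monomial k ((k.factorial : ℂ)⁻¹ * iteratedDeriv k H 0), ?_, ?_⟩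
  · refine natDegree_sum_le_of_forall_le _ _ fun k hk => (natDegree_monomial_le _).trans ?_
    simpa [Nat.lt_succ_iff] using hk
  · intro z
    have h1 := Complex.hasSum_taylorSeries_of_entire hH 0 z
    rw [← h1.tsum_eq, tsum_eq_sum (s := Finset.range (N + 1))]
    · rw [eval_finsetSum]
      refine Finset.sum_congr rfl fun k _ => ?_
      simp only [eval_monomial, sub_zero, smul_eq_mul]
      ring
    · intro k hk
      rw [hzero k (by simpa using hk)]
      simp

/-- If `F` is dominated by a polynomial multiple of `G`, then `F` is a polynomial multiple of
`G`. -/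
theorem exists_polynomial_mul_eq_of_entire {F G : ℂ → ℂ} (hF : Differentiable ℂ F)
    (hG : Differentiable ℂ G) {z₀ : ℂ} (hG0 : G z₀ ≠ 0) {C : ℝ} {N : ℕ}
    (hb : ∀ z, ‖F z‖ ≤ C * (1 + ‖z‖) ^ N * ‖G z‖) :
    ∃ q : ℂ[X], q.natDegree ≤ N ∧ ∀ z, F z = G z * q.eval z := by
  have hC : 0 ≤ C := by
    by_contra h
    push Not at h
    have h1 := (norm_nonneg _).trans (hb z₀)
    have h2 : 0 < (1 + ‖z₀‖) ^ N * ‖G z₀‖ := by positivity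
    nlinarith
  have hm : Meromorphic (F / G) := fun z =>
    (hF.analyticAt z).meromorphicAt.div (hG.analyticAt z).meromorphicAt
  have hbq : ∀ z, ‖(F / G) z‖ ≤ C * (1 + ‖z‖) ^ N := by
    intro z
    by_cases h : G z = 0
    · simp only [Pi.div_apply, h, div_zero, norm_zero]; positivity
    · rw [Pi.div_apply, norm_div, div_le_iff₀ (norm_pos_iff.2 h)]; exact hb z
  have hmo : MeromorphicOn (F / G) Set.univ := fun z _ => hm z
  set H := toMeromorphicNFOn (F / G) Set.univ with hHdef
  have hHeq : ∀ z, ∀ᶠ w in 𝓝[≠] z, (F / G) w = H w := fun z =>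
    (hmo.toMeromorphicNFOn_eq_self_on_nhdsNE (Set.mem_univ z)).mono fun w hw => hw.symm
  have hHan : ∀ z, AnalyticAt ℂ H z := by
    intro z
    have hnf : MeromorphicNFAt H z := meromorphicNFOn_toMeromorphicNFOn _ _ (Set.mem_univ z)
    rw [← hnf.meromorphicOrderAt_nonneg_iff_analyticAt, hHdef,
      meromorphicOrderAt_toMeromorphicNFOn hmo (Set.mem_univ z)]
    by_contra hneg
    push Not at hneg
    have ht := (tendsto_cobounded_iff_meromorphicOrderAt_neg (hm z)).2 hneg
    have ht' := tendsto_norm_cobounded_atTop.comp ht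
    have h1 : Tendsto (fun w : ℂ => C * (1 + ‖w‖) ^ N) (𝓝[≠] z) (𝓝 (C * (1 + ‖z‖) ^ N)) :=
      tendsto_nhdsWithin_of_tendsto_nhds (Continuous.tendsto (by fun_prop) z)
    exact not_tendsto_atTop_of_tendsto_nhds h1 (tendsto_atTop_mono hbq ht')
  have hHd : Differentiable ℂ H := fun z => (hHan z).differentiableAt
  have hHb : ∀ z, ‖H z‖ ≤ C * (1 + ‖z‖) ^ N := by
    intro z
    have h1 : Tendsto (fun w : ℂ => C * (1 + ‖w‖) ^ N) (𝓝[≠] z) (𝓝 (C * (1 + ‖z‖) ^ N)) :=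
      tendsto_nhdsWithin_of_tendsto_nhds (Continuous.tendsto (by fun_prop) z)
    have h2 : Tendsto (fun w : ℂ => ‖H w‖) (𝓝[≠] z) (𝓝 ‖H z‖) :=
      tendsto_nhdsWithin_of_tendsto_nhds (hHd.continuous.norm.tendsto z)
    refine le_of_tendsto_of_tendsto h2 h1 ?_
    filter_upwards [hHeq z] with w hw
    rw [← hw]; exact hbq w
  obtain ⟨q, hq, hqe⟩ := exists_polynomial_of_entire_of_growth hHd hHb
  refine ⟨q, hq, fun z => ?_⟩
  rw [← hqe]
  have h1 : Tendsto F (𝓝[≠] z) (𝓝 (F z)) :=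
    tendsto_nhdsWithin_of_tendsto_nhds (hF.continuous.tendsto z)
  have h2 : Tendsto (fun w => G w * H w) (𝓝[≠] z) (𝓝 (G z * H z)) :=
    tendsto_nhdsWithin_of_tendsto_nhds ((hG.continuous.mul hHd.continuous).tendsto z)
  refine tendsto_nhds_unique_of_eventuallyEq h1 h2 ?_
  filter_upwards [hHeq z] with w hw
  rw [← hw, Pi.div_apply]
  by_cases h : G w = 0
  · have := hb w
    simp only [h, norm_zero, mul_zero, norm_le_zero_iff] at this
    simp [h, this]
  · field_simp

/-- The polynomial of real parts of the coefficients. -/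
theorem exists_real_polynomial_re (q : ℂ[X]) :
    ∃ p : ℝ[X], p.natDegree ≤ q.natDegree ∧ ∀ s : ℝ, p.eval s = (q.eval (s : ℂ)).re := by
  refine ⟨∑ k ∈ Finset.range (q.natDegree + 1), monomial k (q.coeff k).re, ?_, ?_⟩
  · refine natDegree_sum_le_of_forall_le _ _ fun k hk => (natDegree_monomial_le _).trans ?_
    simpa [Nat.lt_succ_iff] using hk
  · intro s
    rw [eval_finsetSum, eval_eq_sum_range, Complex.re_sum]
    refine Finset.sum_congr rfl fun k _ => ?_
    rw [← Complex.ofReal_pow]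
    simp [Complex.mul_re, - Complex.ofReal_pow]

/-- Real form of `exists_polynomial_mul_eq_of_entire`. -/
theorem exists_real_polynomial_mul_eq {f g : ℝ → ℝ} {F G : ℂ → ℂ} (hF : Differentiable ℂ F)
    (hG : Differentiable ℂ G) (hFf : ∀ s : ℝ, F s = f s) (hGg : ∀ s : ℝ, G s = g s)
    {s₀ : ℝ} (hg : g s₀ ≠ 0) {C : ℝ} {N : ℕ}
    (hb : ∀ z, ‖F z‖ ≤ C * (1 + ‖z‖) ^ N * ‖G z‖) :
    ∃ q : ℝ[X], q.natDegree ≤ N ∧ ∀ s, f s = g s * q.eval s := by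
  obtain ⟨q, hq, hqe⟩ := exists_polynomial_mul_eq_of_entire hF hG (z₀ := s₀)
    (by rw [hGg]; exact_mod_cast hg) hb
  obtain ⟨p, hp, hpe⟩ := exists_real_polynomial_re q
  refine ⟨p, hp.trans hq, fun s => ?_⟩
  have := hqe s
  rw [hFf, hGg] at this
  have := congrArg Complex.re this
  simpa [hpe] using this

/-- A function on a product of infinite sets that is a polynomial of bounded degree in each
variable separately is a polynomial. -/
theorem exists_mvPolynomial_of_separately {m N : ℕ} (S : Fin m → Set ℝ) (hS : ∀ i, (S i).Infinite)
    (F : (Fin m → ℝ) → ℝ)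
    (h : ∀ z ∈ Set.univ.pi S, ∀ i, ∃ q : ℝ[X], q.natDegree ≤ N ∧
      ∀ t ∈ S i, F (Function.update z i t) = q.eval t) :
    ∃ T : MvPolynomial (Fin m) ℝ, ∀ z ∈ Set.univ.pi S, F z = MvPolynomial.eval z T := by
  induction m with
  | zero =>
    refine ⟨MvPolynomial.C (F default), fun z _ => ?_⟩
    rw [MvPolynomial.eval_C, Subsingleton.elim z default]
  | succ m ih =>
    obtain ⟨A, hAS, hA⟩ := (hS 0).exists_subset_card_eq (N + 1)
    have hT : ∀ a ∈ S 0, ∃ T : MvPolynomial (Fin m) ℝ, ∀ z ∈ Set.univ.pi (fun i => S i.succ),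
        F (Fin.cons a z) = MvPolynomial.eval z T := by
      intro a ha
      refine ih (fun i => S i.succ) (fun i => hS _) (fun z => F (Fin.cons a z)) ?_
      intro z hz i
      obtain ⟨q, hq, hqe⟩ := h (Fin.cons a z) (by
        intro j _
        refine Fin.cases ?_ (fun j => ?_) j
        · simpa using ha
        · simpa using hz j trivial) i.succ
      exact ⟨q, hq, fun t ht => by rw [← hqe t ht, Fin.cons_update]⟩
    choose! T hT using hT
    refine ⟨∑ a ∈ A, MvPolynomial.rename Fin.succ (T a) *
      aeval (MvPolynomial.X 0 : MvPolynomial (Fin (m + 1)) ℝ) (Lagrange.basis A id a), ?_⟩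
    intro z hz
    have hz0 : z 0 ∈ S 0 := hz 0 trivial
    have hzs : Fin.tail z ∈ Set.univ.pi (fun i => S i.succ) := fun i _ => hz i.succ trivial
    obtain ⟨q, hq, hqe⟩ := h z hz 0
    have hcons : ∀ t, Function.update z 0 t = Fin.cons t (Fin.tail z) := by
      intro t
      conv_lhs => rw [← Fin.cons_self_tail z]
      rw [Fin.update_cons_zero]
    have h1 : q = Lagrange.interpolate A id (fun a => q.eval a) := by
      refine Lagrange.eq_interpolate (fun _ _ _ _ h => h) ?_
      rw [hA]
      exact degree_le_natDegree.trans_lt (by exact_mod_cast Nat.lt_succ_of_le hq)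
    have h2 : F z = q.eval (z 0) := by
      rw [← hqe _ hz0, Function.update_eq_self]
    rw [h2, h1, Lagrange.interpolate_apply, eval_finsetSum, map_sum]
    refine Finset.sum_congr rfl fun a ha => ?_
    have haS : a ∈ S 0 := hAS ha
    rw [eval_mul, eval_C, ← hqe a haS, hcons, hT a haS _ hzs, map_mul, MvPolynomial.eval_rename]
    congr 1
    rw [← MvPolynomial.coe_aeval_eq_eval, RingHom.coe_coe, ← aeval_algHom_apply]
    simp [coe_aeval_eq_eval]

/-- A function with polynomial derivative is a polynomial. -/
theorem exists_polynomial_of_hasDerivAt {f : ℝ → ℝ} {q : ℝ[X]}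
    (h : ∀ t, HasDerivAt f (q.eval t) t) :
    ∃ Q : ℝ[X], Q.natDegree ≤ q.natDegree + 1 ∧ ∀ t, f t = Q.eval t := by
  set P : ℝ[X] := ∑ k ∈ Finset.range (q.natDegree + 1), monomial (k + 1) (q.coeff k / (k + 1))
    with hP
  have hdP : derivative P = q := by
    conv_rhs => rw [q.as_sum_range]
    rw [hP, derivative_sum]
    refine Finset.sum_congr rfl fun k _ => ?_
    rw [derivative_monomial]
    congr 1
    push_cast
    field_simp
  refine ⟨P + C (f 0 - P.eval 0), ?_, fun t => ?_⟩
  · rw [natDegree_add_C]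
    refine natDegree_sum_le_of_forall_le _ _ fun k hk => (natDegree_monomial_le _).trans ?_
    have := Finset.mem_range.1 hk
    omega
  · have hd : ∀ t, HasDerivAt (fun t => f t - P.eval t) 0 t := by
      intro t
      have := (h t).sub (P.hasDerivAt t)
      rwa [hdP, sub_self] at this
    have := is_const_of_deriv_eq_zero (fun t => (hd t).differentiableAt)
      (fun t => (hd t).deriv) t 0
    simp only [eval_add, eval_C]
    linarith

end

section

open Polynomial Filter Topology
open scoped ContDiff

/-- The directional derivative of `f` along `e`. -/
def dirDeriv {E : Type*} [NormedAddCommGroup E] [NormedSpace ℝ E] (e : E) (f : E → ℝ) : E → ℝ :=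
  fun x => fderiv ℝ f x e

section dirDeriv

variable {E : Type*} [NormedAddCommGroup E] [NormedSpace ℝ E] {f g : E → ℝ}

theorem ContDiff.dirDeriv (hf : ContDiff ℝ ∞ f) (e : E) : ContDiff ℝ ∞ (dirDeriv e f) :=
  (hf.fderiv_right (m := ∞) (by simp)).clm_apply contDiff_const

theorem ContDiff.dirDeriv_iterate (hf : ContDiff ℝ ∞ f) (e : E) (k : ℕ) :
    ContDiff ℝ ∞ ((_root_.dirDeriv e)^[k] f) := by
  induction k with
  | zero => exact hf
  | succ k ih => rw [Function.iterate_succ_apply']; exact ih.dirDeriv e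

theorem ContDiff.differentiable_infty (hf : ContDiff ℝ ∞ f) : Differentiable ℝ f :=
  hf.differentiable (by simp)

theorem dirDeriv_comm (hf : ContDiff ℝ ∞ f) (d e : E) :
    dirDeriv d (dirDeriv e f) = dirDeriv e (dirDeriv d f) := by
  have hd : Differentiable ℝ (fderiv ℝ f) :=
    (hf.fderiv_right (m := ∞) (by simp)).differentiable (by simp)
  have key : ∀ (a b : E) (x : E), dirDeriv a (dirDeriv b f) x = fderiv ℝ (fderiv ℝ f) x a b := by
    intro a b x
    have : HasFDerivAt (dirDeriv b f) ((fderiv ℝ (fderiv ℝ f) x).flip b) x := by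
      have := (hd x).hasFDerivAt.clm_apply (hasFDerivAt_const b x)
      refine this.congr_fderiv ?_
      ext; simp
    show fderiv ℝ (dirDeriv b f) x a = _
    rw [this.fderiv]
    rfl
  funext x
  rw [key, key]
  exact second_derivative_symmetric (fun y => (hf.differentiable_infty y).hasFDerivAt)
    (hd x).hasFDerivAt d e

theorem dirDeriv_add (hf : Differentiable ℝ f) (hg : Differentiable ℝ g) (e : E) :
    dirDeriv e (f + g) = dirDeriv e f + dirDeriv e g := by
  funext x; simp [dirDeriv, fderiv_add (hf x) (hg x)]

theorem dirDeriv_const_mul (c : ℝ) (hf : Differentiable ℝ f) (e : E) :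
    dirDeriv e (fun x => c * f x) = fun x => c * dirDeriv e f x := by
  funext x; simp [dirDeriv, fderiv_const_mul (hf x)]

theorem dirDeriv_mul (hf : Differentiable ℝ f) (hg : Differentiable ℝ g) (e : E) :
    dirDeriv e (fun x => f x * g x) = fun x => f x * dirDeriv e g x + dirDeriv e f x * g x := by
  funext x
  simp only [dirDeriv]
  rw [fderiv_fun_mul (hf x) (hg x)]
  simp [mul_comm]

theorem dirDeriv_sum {ι : Type*} (s : Finset ι) {F : ι → E → ℝ}
    (hF : ∀ i ∈ s, Differentiable ℝ (F i)) (e : E) :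
    dirDeriv e (fun x => ∑ i ∈ s, F i x) = fun x => ∑ i ∈ s, dirDeriv e (F i) x := by
  funext x
  simp only [dirDeriv]
  rw [fderiv_fun_sum (fun i hi => hF i hi x)]
  simp

theorem hasDerivAt_comp_line (hf : Differentiable ℝ f) (x e : E) (s : ℝ) :
    HasDerivAt (fun s : ℝ => f (x + s • e)) (dirDeriv e f (x + s • e)) s := by
  have h1 : HasDerivAt (fun s : ℝ => x + s • e) e s := by
    simpa using ((hasDerivAt_id s).smul_const e).const_add x
  exact (hf _).hasFDerivAt.comp_hasDerivAt s h1

theorem dirDeriv_comp_add_smul (hf : Differentiable ℝ f) (x e : E) (s : ℝ) :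
    dirDeriv e (fun y => f (x + s • y)) = fun y => s * dirDeriv e f (x + s • y) := by
  funext y
  have h1 : HasFDerivAt (fun y : E => x + s • y) (s • ContinuousLinearMap.id ℝ E) y :=
    ((hasFDerivAt_id y).const_smul s).const_add x
  have := (hf (x + s • y)).hasFDerivAt.comp y h1
  simp only [dirDeriv]
  rw [show fderiv ℝ (fun y => f (x + s • y)) y = _ from this.fderiv]
  simp

end dirDeriv

/-- Differentiation under the integral sign, for continuous integrands supported in a fixed
compact set. -/
theorem hasDerivAt_integral_of_compact {E : Type*} [NormedAddCommGroup E]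
    [NormedSpace ℝ E] [MeasurableSpace E] [BorelSpace E] [FiniteDimensional ℝ E] {μ : Measure E}
    [IsFiniteMeasureOnCompacts μ] {F F' : ℝ → E → ℝ} {K : Set E} (hK : IsCompact K)
    (hF : ∀ s, Continuous (F s)) (hF' : Continuous (fun p : ℝ × E => F' p.1 p.2))
    (hd : ∀ s y, HasDerivAt (fun s => F s y) (F' s y) s)
    (hs : ∀ s, ∀ y ∉ K, F s y = 0) (hs' : ∀ s, ∀ y ∉ K, F' s y = 0) (s₀ : ℝ) :
    HasDerivAt (fun s => ∫ y, F s y ∂μ) (∫ y, F' s₀ y ∂μ) s₀ := by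
  obtain ⟨M, hM⟩ := ((isCompact_closedBall s₀ 1).prod hK).exists_bound_of_continuousOn
    hF'.continuousOn
  have hFi : ∀ s, Integrable (F s) μ := fun s =>
    (hF s).integrable_of_hasCompactSupport (HasCompactSupport.intro hK (hs s))
  refine (hasDerivAt_integral_of_dominated_loc_of_deriv_le (bound := K.indicator fun _ => M)
    (ball_mem_nhds s₀ one_pos) (Eventually.of_forall fun s => (hF s).aestronglyMeasurable)
    (hFi s₀) (F' := F') ?_ ?_ ?_ ?_).2
  · exact Continuous.aestronglyMeasurable (by fun_prop)
  · refine Eventually.of_forall fun y s hs1 => ?_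
    by_cases hy : y ∈ K
    · rw [Set.indicator_of_mem hy]
      exact hM (s, y) ⟨ball_subset_closedBall hs1, hy⟩
    · rw [Set.indicator_of_notMem hy, hs' s y hy, norm_zero]
  · exact (integrable_indicator_iff hK.measurableSet).2 (integrableOn_const hK.measure_lt_top.ne)
  · exact Eventually.of_forall fun y s _ => hd s y

/-- Euclidean space of dimension `n`. -/
abbrev Euc (n : ℕ) := EuclideanSpace ℝ (Fin n)

variable {n : ℕ}

/-- The partial derivative in the `i`-th coordinate direction. -/
abbrev partialD (i : Fin n) (f : Euc n → ℝ) : Euc n → ℝ := dirDeriv (EuclideanSpace.single i 1) f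

/-- The constant coefficient second order operator with matrix `A`. -/
def ellipticOp (A : Matrix (Fin n) (Fin n) ℝ) (f : Euc n → ℝ) : Euc n → ℝ :=
  fun x => ∑ i, ∑ j, A i j * partialD i (partialD j f) x

theorem dirDeriv_eq_sum (f : Euc n → ℝ) (e x : Euc n) :
    dirDeriv e f x = ∑ i, e i * partialD i f x := by
  conv_lhs => rw [← (EuclideanSpace.basisFun (Fin n) ℝ).sum_repr e]
  simp [dirDeriv]

/-- A smooth proper function adapted to the operator with matrix `A`. -/
structure IsGauge (A : Matrix (Fin n) (Fin n) ℝ) (ρ : Euc n → ℝ) : Prop where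
  contDiff : ContDiff ℝ ∞ ρ
  grad : ∀ y i, ∑ j, A i j * partialD j ρ y = 2 * y i
  zero : ρ 0 = 0
  isCompact : IsCompact {y | ρ y ≤ 1}

theorem exists_isGauge {A : Matrix (Fin n) (Fin n) ℝ} (hA : A.PosDef) : ∃ ρ, IsGauge A ρ := by
  classical
  set B := A⁻¹ with hB
  have hBp : B.PosDef := hA.inv
  have hAB : A * B = 1 := Matrix.mul_nonsing_inv _ ((Matrix.isUnit_iff_isUnit_det _).1 hA.isUnit)
  set ρ : Euc n → ℝ := fun y => ∑ i, ∑ j, B i j * (y i * y j) with hρ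
  have hρ' : ∀ y : Euc n, ρ y = (fun i => y i) ⬝ᵥ (B.mulVec fun i => y i) := by
    intro y
    simp only [hρ, dotProduct, Matrix.mulVec, Finset.mul_sum]
    exact Finset.sum_congr rfl fun i _ => Finset.sum_congr rfl fun j _ => by ring
  have hsmooth : ContDiff ℝ ∞ ρ := by
    refine ContDiff.sum fun i _ => ContDiff.sum fun j _ => contDiff_const.mul ?_
    exact (EuclideanSpace.proj (𝕜 := ℝ) i).contDiff.mul (EuclideanSpace.proj (𝕜 := ℝ) j).contDiff
  have hpos : ∀ y, y ≠ 0 → 0 < ρ y := by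
    intro y hy
    rw [hρ']
    have := hBp.dotProduct_mulVec_pos (x := fun i => y i) (by
      intro h; apply hy; ext i; exact congrFun h i)
    simpa using this
  have hzero : ρ 0 = 0 := by simp [hρ]
  refine ⟨ρ, hsmooth, ?_, hzero, ?_⟩
  · intro y i
    have hpd : ∀ j, partialD j ρ y = 2 * ∑ k, B j k * y k := by
      intro j
      have hpr : ∀ k, HasFDerivAt (fun y : Euc n => y k) (EuclideanSpace.proj (𝕜 := ℝ) k) y :=
        fun k => (EuclideanSpace.proj (𝕜 := ℝ) k).hasFDerivAt
      have h1 : HasFDerivAt ρ (∑ i, ∑ k, B i k • (y i • (EuclideanSpace.proj (𝕜 := ℝ) k) +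
          y k • (EuclideanSpace.proj (𝕜 := ℝ) i) : Euc n →L[ℝ] ℝ)) y :=
        HasFDerivAt.fun_sum fun i _ => HasFDerivAt.fun_sum fun k _ =>
          ((hpr i).mul (hpr k)).const_mul _
      have h2 : ∀ i j, B i j = B j i := fun i j => by
        have := hBp.isHermitian.apply i j
        simpa using this.symm
      simp only [partialD, dirDeriv, h1.fderiv]
      have hps : ∀ k, EuclideanSpace.proj (𝕜 := ℝ) k (EuclideanSpace.single j (1 : ℝ)) =
          if k = j then 1 else 0 := fun k => by simp
      simp only [_root_.sum_apply, _root_.smul_apply, _root_.add_apply, smul_eq_mul, hps]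
      simp only [mul_add, Finset.sum_add_distrib, mul_ite, mul_one, mul_zero, Finset.sum_ite_eq',
        Finset.mem_univ, if_true, Finset.sum_ite_irrel, Finset.sum_const_zero, two_mul]
      congr 1
      exact Finset.sum_congr rfl fun k _ => by rw [h2]
    simp only [hpd]
    have : ∀ j, A i j * (2 * ∑ k, B j k * y k) = ∑ k, 2 * (A i j * B j k) * y k := fun j => by
      rw [Finset.mul_sum, Finset.mul_sum]; exact Finset.sum_congr rfl fun k _ => by ring
    simp only [this]
    rw [Finset.sum_comm]
    have h3 : ∀ k, ∑ j, 2 * (A i j * B j k) * y k = 2 * (if i = k then y k else 0) := fun k => by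
      rw [← Finset.sum_mul, ← Finset.mul_sum, ← Matrix.mul_apply, hAB, Matrix.one_apply]
      split_ifs <;> ring
    simp [h3]
  · have hc : ∃ c > 0, ∀ y, c * ‖y‖ ^ 2 ≤ ρ y := by
      have hhom : ∀ (t : ℝ) y, ρ (t • y) = t ^ 2 * ρ y := fun t y => by
        simp only [hρ, Finset.mul_sum]
        exact Finset.sum_congr rfl fun i _ => Finset.sum_congr rfl fun j _ => by
          simp; ring
      rcases (sphere (0 : Euc n) 1).eq_empty_or_nonempty with h | h
      · refine ⟨1, one_pos, fun y => ?_⟩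
        have : y = 0 := by
          by_contra hy
          have : ‖y‖⁻¹ • y ∈ sphere (0 : Euc n) 1 := by
            simp [norm_smul, norm_ne_zero_iff.2 hy]
          rw [h] at this; exact this
        simp [this, hzero]
      · obtain ⟨z, hz, hmin⟩ := (isCompact_sphere (0 : Euc n) 1).exists_isMinOn h
          hsmooth.continuous.continuousOn
        refine ⟨ρ z, hpos z (by rintro rfl; simp at hz), fun y => ?_⟩
        by_cases hy : y = 0
        · simp [hy, hzero]
        have h1 : ‖y‖⁻¹ • y ∈ sphere (0 : Euc n) 1 := by
            simp [norm_smul, norm_ne_zero_iff.2 hy]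
        have h2 : ρ z ≤ ρ (‖y‖⁻¹ • y) := hmin h1
        rw [hhom] at h2
        have h3 : 0 < ‖y‖ := norm_pos_iff.2 hy
        calc ρ z * ‖y‖ ^ 2 ≤ ‖y‖⁻¹ ^ 2 * ρ y * ‖y‖ ^ 2 := by gcongr
          _ = ρ y := by field_simp
    obtain ⟨c, hc0, hc⟩ := hc
    refine Metric.isCompact_of_isClosed_isBounded
      (isClosed_le hsmooth.continuous continuous_const) ?_
    refine (isBounded_closedBall (x := (0 : Euc n)) (r := c⁻¹ + 1)).subset fun y hy => ?_
    rw [mem_closedBall_zero_iff]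
    have h1 : c * ‖y‖ ^ 2 ≤ 1 := (hc y).trans hy
    by_contra hlt
    push Not at hlt
    have h2 : 0 < c⁻¹ := inv_pos.2 hc0
    have h4 : c * c⁻¹ = 1 := mul_inv_cancel₀ hc0.ne'
    have h5 : 1 < ‖y‖ := by linarith
    have h6 : c * (c⁻¹+1) < c * ‖y‖ := by gcongr
    nlinarith

end

section

open Polynomial Filter Topology
open scoped ContDiff

variable {n : ℕ}

variable {A : Matrix (Fin n) (Fin n) ℝ} {ρ w v : Euc n → ℝ} {φ Φ : ℝ → ℝ}

theorem IsGauge.comp_eq_zero (hφ0 : ∀ r, 1 ≤ r → φ r = 0) {y : Euc n} (hy : y ∉ {y | ρ y ≤ 1}) :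
    φ (ρ y) = 0 :=
  hφ0 _ (not_le.1 hy).le

theorem IsGauge.hasCompactSupport_mul (hρ : IsGauge A ρ) (f : Euc n → ℝ)
    (hφ0 : ∀ r, 1 ≤ r → φ r = 0) : HasCompactSupport fun y => f y * φ (ρ y) :=
  HasCompactSupport.intro hρ.isCompact fun y hy => by
    rw [IsGauge.comp_eq_zero hφ0 hy, mul_zero]

theorem IsGauge.integrable_mul (hρ : IsGauge A ρ) {f : Euc n → ℝ} (hf : Continuous f)
    (hφ : Continuous φ) (hφ0 : ∀ r, 1 ≤ r → φ r = 0) : Integrable fun y => f y * φ (ρ y) :=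
  (hf.mul (hφ.comp hρ.contDiff.continuous)).integrable_of_hasCompactSupport
    (hρ.hasCompactSupport_mul f hφ0)

theorem exists_half_primitive (hφ : ContDiff ℝ ∞ φ) (hφ0 : ∀ r, 1 ≤ r → φ r = 0) :
    ∃ Φ : ℝ → ℝ, ContDiff ℝ ∞ Φ ∧ (∀ r, 1 ≤ r → Φ r = 0) ∧ ∀ r, HasDerivAt Φ (φ r / 2) r := by
  have hd : ∀ r, HasDerivAt (fun r => (∫ t in (1 : ℝ)..r, φ t) / 2) (φ r / 2) r := fun r =>
    (hφ.continuous.integral_hasStrictDerivAt 1 r).hasDerivAt.div_const 2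
  refine ⟨_, ?_, ?_, hd⟩
  · rw [contDiff_infty_iff_deriv]
    refine ⟨fun r => (hd r).differentiableAt, ?_⟩
    rw [show deriv _ = fun r => φ r / 2 from funext fun r => (hd r).deriv]
    exact hφ.div_const 2
  · intro r hr
    have : ∫ t in (1 : ℝ)..r, φ t = ∫ t in (1 : ℝ)..r, (0 : ℝ) :=
      intervalIntegral.integral_congr fun t ht => by
        rw [Set.uIcc_of_le hr] at ht
        exact hφ0 t ht.1
    simp [this]

theorem IsGauge.hasDerivAt_integral (hρ : IsGauge A ρ) (hw : ContDiff ℝ ∞ w)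
    (hφ : ContDiff ℝ ∞ φ) (hφ0 : ∀ r, 1 ≤ r → φ r = 0)
    (hΦ : ContDiff ℝ ∞ Φ) (hΦ0 : ∀ r, 1 ≤ r → Φ r = 0)
    (hd : ∀ r, HasDerivAt Φ (φ r / 2) r) (x : Euc n) (s : ℝ) :
    HasDerivAt (fun s : ℝ => ∫ y, w (x + s • y) * φ (ρ y))
      (-(s * ∫ y, ellipticOp A w (x + s • y) * Φ (ρ y))) s := by
  have hwc := hw.continuous
  have hρc := hρ.contDiff.continuous
  have hφc := hφ.continuous
  have hΦc := hΦ.continuous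
  have hfw : Continuous (fderiv ℝ w) := (hw.fderiv_right (m := ∞) (by simp)).continuous
  have h1 := hasDerivAt_integral_of_compact (μ := (volume : Measure (Euc n)))
    (F := fun s y => w (x + s • y) * φ (ρ y))
    (F' := fun s y => dirDeriv y w (x + s • y) * φ (ρ y)) hρ.isCompact
    (fun s => by fun_prop) (by unfold dirDeriv; fun_prop)
    (fun s y => (hasDerivAt_comp_line hw.differentiable_infty x y s).mul_const _)
    (fun s y hy => by rw [IsGauge.comp_eq_zero hφ0 hy, mul_zero])
    (fun s y hy => by rw [IsGauge.comp_eq_zero hφ0 hy, mul_zero]) s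
  refine h1.congr_deriv ?_
  have hψ : ∀ j y, partialD j (fun y => Φ (ρ y)) y = partialD j ρ y * (φ (ρ y) / 2) := by
    intro j y
    have := (hd (ρ y)).hasFDerivAt.comp y (hρ.contDiff.differentiable_infty y).hasFDerivAt
    simp only [partialD, dirDeriv]
    rw [show fderiv ℝ (fun y => Φ (ρ y)) y = _ from this.fderiv]
    simp
  have hpw : ∀ i, Continuous (partialD i w) := fun i => (hw.dirDeriv _).continuous
  have hpρ : ∀ i, Continuous (partialD i ρ) := fun i => (hρ.contDiff.dirDeriv _).continuous
  have hppw : ∀ i j, Continuous (partialD i (partialD j w)) :=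
    fun i j => ((hw.dirDeriv _).dirDeriv _).continuous
  have hφ2 : ∀ r, 1 ≤ r → φ r / 2 = 0 := fun r hr => by rw [hφ0 r hr, zero_div]
  have hintegrable : ∀ i j, Integrable fun y => partialD i w (x + s • y) *
      partialD j (fun y => Φ (ρ y)) y := by
    intro i j
    have := hρ.integrable_mul (f := fun y => partialD i w (x + s • y) * partialD j ρ y)
      (by fun_prop) (φ := fun r => φ r / 2) (by fun_prop) hφ2
    refine this.congr (Eventually.of_forall fun y => ?_)
    simp only [hψ]; ring
  have hibp : ∀ i j, ∫ y, partialD i w (x + s • y) * partialD j (fun y => Φ (ρ y)) y =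
      - ∫ y, s * partialD j (partialD i w) (x + s • y) * Φ (ρ y) := by
    intro i j
    have hdw : Differentiable ℝ (partialD i w) := (hw.dirDeriv _).differentiable_infty
    have hds : ∀ y, fderiv ℝ (fun y => partialD i w (x + s • y)) y (EuclideanSpace.single j 1) =
        s * partialD j (partialD i w) (x + s • y) := fun y => by
      have h1 : HasFDerivAt (fun y : Euc n => x + s • y) (s • ContinuousLinearMap.id ℝ _) y :=
        ((hasFDerivAt_id y).const_smul s).const_add x
      have := (hdw (x + s • y)).hasFDerivAt.comp y h1
      rw [show fderiv ℝ (fun y => partialD i w (x + s • y)) y = _ from this.fderiv]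
      simp [dirDeriv]
    have := integral_mul_fderiv_eq_neg_fderiv_mul_of_integrable (μ := (volume : Measure (Euc n)))
      (f := fun y => partialD i w (x + s • y)) (g := fun y => Φ (ρ y))
      (v := EuclideanSpace.single j 1) ?_ (hintegrable i j) ?_ ?_ ?_
    · simp only [hds] at this
      exact this
    · simp only [hds]
      exact hρ.integrable_mul (by fun_prop) hΦc hΦ0
    · exact hρ.integrable_mul (by fun_prop) hΦc hΦ0
    · intro y _
      exact (hdw _).comp y (by fun_prop)
    · intro y _
      exact (hΦ.differentiable_infty _).comp y (hρ.contDiff.differentiable_infty _)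
  have hexp : ∀ y, dirDeriv y w (x + s • y) * φ (ρ y) =
      ∑ i, ∑ j, A i j * (partialD i w (x + s • y) * partialD j (fun y => Φ (ρ y)) y) := by
    intro y
    rw [dirDeriv_eq_sum, Finset.sum_mul]
    refine Finset.sum_congr rfl fun i _ => ?_
    have : ∀ j, A i j * (partialD i w (x + s • y) * partialD j (fun y => Φ (ρ y)) y) =
        (A i j * partialD j ρ y) * (partialD i w (x + s • y) * (φ (ρ y) / 2)) := fun j => by
      rw [hψ]; ring
    simp only [this]
    rw [← Finset.sum_mul, hρ.grad]
    ring
  simp only [hexp]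
  have hi1 : ∀ i j, Integrable fun y => A i j *
      (partialD i w (x + s • y) * partialD j (fun y => Φ (ρ y)) y) :=
    fun i j => (hintegrable i j).const_mul _
  rw [integral_finsetSum _ fun i _ => integrable_finsetSum _ fun j _ => hi1 i j]
  have hr : ∫ y, ellipticOp A w (x + s • y) * Φ (ρ y) =
      ∑ i, ∑ j, A i j * ∫ y, partialD i (partialD j w) (x + s • y) * Φ (ρ y) := by
    have hi2 : ∀ i j, Integrable fun y => A i j *
        (partialD i (partialD j w) (x + s • y) * Φ (ρ y)) := fun i j =>
      (hρ.integrable_mul (by fun_prop) hΦc hΦ0).const_mul _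
    simp only [ellipticOp, Finset.sum_mul, mul_assoc]
    rw [integral_finsetSum _ fun i _ => integrable_finsetSum _ fun j _ => hi2 i j]
    refine Finset.sum_congr rfl fun i _ => ?_
    rw [integral_finsetSum _ fun j _ => hi2 i j]
    exact Finset.sum_congr rfl fun j _ => integral_const_mul _ _
  rw [hr, Finset.mul_sum, ← Finset.sum_neg_distrib]
  refine Finset.sum_congr rfl fun i _ => ?_
  rw [integral_finsetSum _ fun j _ => hi1 i j, Finset.mul_sum,
    ← Finset.sum_neg_distrib]
  refine Finset.sum_congr rfl fun j _ => ?_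
  rw [integral_const_mul, hibp]
  simp only [mul_assoc]
  rw [integral_const_mul]
  rw [show partialD i (partialD j w) = partialD j (partialD i w) from dirDeriv_comm hw _ _]
  ring

end

section

open Polynomial Filter Topology
open scoped ContDiff

variable {n : ℕ}
variable {A : Matrix (Fin n) (Fin n) ℝ} {ρ w v : Euc n → ℝ} {φ Φ : ℝ → ℝ}

theorem ellipticOp_zero : ellipticOp A 0 = 0 := by
  have h : ∀ i, partialD i (0 : Euc n → ℝ) = 0 := fun i => by funext x; simp [dirDeriv]
  funext x; simp [ellipticOp, h]

theorem ellipticOp_add (hv : ContDiff ℝ ∞ v) (hw : ContDiff ℝ ∞ w) :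
    ellipticOp A (v + w) = ellipticOp A v + ellipticOp A w := by
  have h1 : ∀ j, partialD j (v + w) = partialD j v + partialD j w := fun j =>
    dirDeriv_add hv.differentiable_infty hw.differentiable_infty _
  have h2 : ∀ i j, partialD i (partialD j v + partialD j w) =
      partialD i (partialD j v) + partialD i (partialD j w) := fun i j =>
    dirDeriv_add (hv.dirDeriv _).differentiable_infty (hw.dirDeriv _).differentiable_infty _
  funext x
  simp only [ellipticOp, h1, h2, Pi.add_apply, mul_add, Finset.sum_add_distrib]

theorem ellipticOp_const_mul (c : ℝ) (hw : ContDiff ℝ ∞ w) :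
    ellipticOp A (fun x => c * w x) = fun x => c * ellipticOp A w x := by
  have h1 : ∀ j, partialD j (fun x => c * w x) = fun x => c * partialD j w x := fun j =>
    dirDeriv_const_mul c hw.differentiable_infty _
  have h2 : ∀ i j, partialD i (fun x => c * partialD j w x) =
      fun x => c * partialD i (partialD j w) x := fun i j =>
    dirDeriv_const_mul c (hw.dirDeriv _).differentiable_infty _
  funext x
  simp only [ellipticOp, h1, h2, Finset.mul_sum]
  exact Finset.sum_congr rfl fun i _ => Finset.sum_congr rfl fun j _ => by ring

theorem ellipticOp_dirDeriv (hw : ContDiff ℝ ∞ w) (e : Euc n) :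
    ellipticOp A (dirDeriv e w) = dirDeriv e (ellipticOp A w) := by
  have h2 : ∀ i j, Differentiable ℝ (fun x => A i j * partialD i (partialD j w) x) := fun i j =>
    ((hw.dirDeriv _).dirDeriv _).differentiable_infty.const_mul _
  have h1 : dirDeriv e (ellipticOp A w) = fun x => ∑ i, ∑ j,
      A i j * dirDeriv e (partialD i (partialD j w)) x := by
    unfold ellipticOp
    rw [dirDeriv_sum _ fun i _ => Differentiable.fun_sum fun j _ => h2 i j]
    funext x
    refine Finset.sum_congr rfl fun i _ => ?_
    rw [dirDeriv_sum _ fun j _ => h2 i j]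
    refine Finset.sum_congr rfl fun j _ => ?_
    rw [dirDeriv_const_mul _ ((hw.dirDeriv _).dirDeriv _).differentiable_infty]
  rw [h1]
  funext x
  refine Finset.sum_congr rfl fun i _ => Finset.sum_congr rfl fun j _ => ?_
  rw [dirDeriv_comm (hw.dirDeriv _) e, dirDeriv_comm hw e]

theorem contDiff_coord (i : Fin n) : ContDiff ℝ ∞ fun x : Euc n => x i :=
  (EuclideanSpace.proj (𝕜 := ℝ) i).contDiff

theorem dirDeriv_coord_mul (hw : Differentiable ℝ w) (i j : Fin n) :
    partialD j (fun x => x i * w x) = fun x => x i * partialD j w x + (if i = j then w x else 0) := by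
  have h : partialD j (fun x : Euc n => x i) = fun _ => if i = j then 1 else 0 := by
    funext x
    have : HasFDerivAt (fun x : Euc n => x i) (EuclideanSpace.proj (𝕜 := ℝ) i) x :=
      (EuclideanSpace.proj (𝕜 := ℝ) i).hasFDerivAt
    simp [dirDeriv, this.fderiv]
  rw [partialD] at h
  rw [partialD, dirDeriv_mul (contDiff_coord i).differentiable_infty hw, h]
  funext x
  simp

theorem ellipticOp_coord_mul (hw : ContDiff ℝ ∞ w) (i : Fin n) :
    ellipticOp A (fun x => x i * w x) =
      (fun x => x i * ellipticOp A w x) + fun x => ∑ j, (A i j + A j i) * partialD j w x := by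
  have h2 : ∀ a b, partialD a (partialD b (fun x => x i * w x)) = fun x =>
      x i * partialD a (partialD b w) x + (if i = a then partialD b w x else 0) +
        (if i = b then partialD a w x else 0) := by
    intro a b
    rw [dirDeriv_coord_mul hw.differentiable_infty]
    have hd : Differentiable ℝ fun x => x i * partialD b w x :=
      ((contDiff_coord i).mul (hw.dirDeriv _)).differentiable_infty
    have hd' : Differentiable ℝ fun x => if i = b then w x else 0 := by
      split_ifs
      · exact hw.differentiable_infty
      · fun_prop
    have := dirDeriv_add hd hd' (EuclideanSpace.single a 1)
    refine this.trans ?_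
    have h3 := dirDeriv_coord_mul (hw.dirDeriv (EuclideanSpace.single b 1)).differentiable_infty i a
    rw [partialD] at h3
    rw [h3]
    funext x
    simp only [Pi.add_apply]
    congr 1
    split_ifs
    · rfl
    · simp [dirDeriv]
  funext x
  simp only [ellipticOp, h2, Pi.add_apply, mul_add, Finset.sum_add_distrib, add_mul,
    Finset.mul_sum, add_assoc]
  congr 1
  · exact Finset.sum_congr rfl fun a _ => Finset.sum_congr rfl fun b _ => by ring
  · simp [Finset.sum_ite_irrel]

/-- `w` is annihilated by the `k`-th power of the operator with matrix `A`. -/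
def IsPolyHarm (A : Matrix (Fin n) (Fin n) ℝ) : ℕ → (Euc n → ℝ) → Prop
  | 0, w => w = 0
  | k + 1, w => ContDiff ℝ ∞ w ∧ IsPolyHarm A k (ellipticOp A w)

namespace IsPolyHarm

variable {k : ℕ}

theorem contDiff (h : IsPolyHarm A k w) : ContDiff ℝ ∞ w := by
  cases k with
  | zero => rw [show w = 0 from h]; exact contDiff_const
  | succ k => exact h.1

theorem succ (h : IsPolyHarm A k w) : IsPolyHarm A (k + 1) w := by
  induction k generalizing w with
  | zero =>
    refine ⟨h.contDiff, ?_⟩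
    rw [show w = 0 from h, ellipticOp_zero]
    rfl
  | succ k ih => exact ⟨h.1, ih h.2⟩

theorem mono {l : ℕ} (h : IsPolyHarm A k w) (hl : k ≤ l) : IsPolyHarm A l w := by
  induction hl with
  | refl => exact h
  | step _ ih => exact ih.succ

protected theorem add (h : IsPolyHarm A k w) (h' : IsPolyHarm A k v) : IsPolyHarm A k (w + v) := by
  induction k generalizing w v with
  | zero => rw [show w = 0 from h, show v = 0 from h']; exact add_zero _
  | succ k ih =>
    refine ⟨h.1.add h'.1, ?_⟩
    rw [ellipticOp_add h.1 h'.1]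
    exact ih h.2 h'.2

protected theorem const_mul (c : ℝ) (h : IsPolyHarm A k w) :
    IsPolyHarm A k fun x => c * w x := by
  induction k generalizing w with
  | zero => rw [show w = 0 from h]; funext x; simp
  | succ k ih =>
    refine ⟨contDiff_const.mul h.1, ?_⟩
    rw [ellipticOp_const_mul c h.1]
    exact ih h.2

protected theorem dirDeriv (e : Euc n) (h : IsPolyHarm A k w) : IsPolyHarm A k (dirDeriv e w) := by
  induction k generalizing w with
  | zero => rw [show w = 0 from h]; funext x; simp [_root_.dirDeriv]
  | succ k ih =>
    refine ⟨h.1.dirDeriv e, ?_⟩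
    rw [ellipticOp_dirDeriv h.1]
    exact ih h.2

theorem sum {ι : Type*} (s : Finset ι) {F : ι → Euc n → ℝ} (h : ∀ i ∈ s, IsPolyHarm A k (F i)) :
    IsPolyHarm A k fun x => ∑ i ∈ s, F i x := by
  classical
  induction s using Finset.induction_on with
  | empty =>
    have : IsPolyHarm A 0 (fun _ => 0 : Euc n → ℝ) := rfl
    simpa using this.mono (Nat.zero_le k)
  | insert a s ha ih =>
    simp only [Finset.sum_insert ha]
    exact (h a (Finset.mem_insert_self _ _)).add
      (ih fun i hi => h i (Finset.mem_insert_of_mem hi))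

theorem coord_mul (h : IsPolyHarm A k w) (i : Fin n) :
    IsPolyHarm A (k + 1) fun x => x i * w x := by
  induction k generalizing w with
  | zero =>
    have : IsPolyHarm A 0 fun x => x i * w x := by
      rw [show w = 0 from h]; funext x; simp
    exact this.succ
  | succ k ih =>
    refine ⟨(contDiff_coord i).mul h.1, ?_⟩
    rw [ellipticOp_coord_mul h.1]
    exact (ih h.2).add (sum _ fun j _ => (h.dirDeriv _).const_mul _)

theorem exists_eval_mul (h : IsPolyHarm A k w) (P : MvPolynomial (Fin n) ℝ) :
    ∃ l, IsPolyHarm A l fun x => MvPolynomial.eval (fun i => x i) P * w x := by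
  induction P using MvPolynomial.induction_on with
  | C a => exact ⟨k, by simpa using h.const_mul a⟩
  | add p q hp hq =>
    obtain ⟨a, ha⟩ := hp
    obtain ⟨b, hb⟩ := hq
    refine ⟨max a b, ?_⟩
    have := (ha.mono (le_max_left a b)).add (hb.mono (le_max_right a b))
    convert this using 1
    funext x
    simp [add_mul]
  | mul_X p i hp =>
    obtain ⟨a, ha⟩ := hp
    refine ⟨a + 1, ?_⟩
    convert ha.coord_mul i using 1
    funext x
    simp; ring

theorem exists_integral_eq_eval (hρ : IsGauge A ρ) (h : IsPolyHarm A k w) (hφ : ContDiff ℝ ∞ φ)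
    (hφ0 : ∀ r, 1 ≤ r → φ r = 0) (x : Euc n) :
    ∃ q : ℝ[X], q.natDegree ≤ 2 * k ∧ ∀ s : ℝ, ∫ y, w (x + s • y) * φ (ρ y) = q.eval s := by
  induction k generalizing w φ with
  | zero =>
    refine ⟨0, by simp, fun s => ?_⟩
    rw [show w = 0 from h]
    simp
  | succ k ih =>
    obtain ⟨Φ, hΦ, hΦ0, hd⟩ := exists_half_primitive hφ hφ0
    obtain ⟨q, hq, hqe⟩ := ih h.2 hΦ hΦ0
    obtain ⟨Q, hQ, hQe⟩ := exists_polynomial_of_hasDerivAt (q := -(X * q))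
      (f := fun s : ℝ => ∫ y, w (x + s • y) * φ (ρ y)) fun s => by
        have := hρ.hasDerivAt_integral h.1 hφ hφ0 hΦ hΦ0 hd x s
        rw [hqe s] at this
        simpa using this
    refine ⟨Q, hQ.trans ?_, hQe⟩
    rw [natDegree_neg]
    have := natDegree_mul_le (p := (X : ℝ[X])) (q := q)
    rw [natDegree_X] at this
    omega

end IsPolyHarm

theorem isPolyHarm_one (hv : ContDiff ℝ ∞ v) (h : ellipticOp A v = 0) : IsPolyHarm A 1 v := ⟨hv, h⟩

/-- The mean value property. -/
theorem IsGauge.integral_eq (hρ : IsGauge A ρ) (hv : ContDiff ℝ ∞ v) (h : ellipticOp A v = 0)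
    (hφ : ContDiff ℝ ∞ φ) (hφ0 : ∀ r, 1 ≤ r → φ r = 0) (x : Euc n) (s : ℝ) :
    ∫ y, v (x + s • y) * φ (ρ y) = v x * ∫ y, φ (ρ y) := by
  obtain ⟨Φ, hΦ, hΦ0, hd⟩ := exists_half_primitive hφ hφ0
  have h0 : ∀ s, HasDerivAt (fun s : ℝ => ∫ y, v (x + s • y) * φ (ρ y)) 0 s := fun s => by
    have := hρ.hasDerivAt_integral hv hφ hφ0 hΦ hΦ0 hd x s
    simpa [h] using this
  have := is_const_of_deriv_eq_zero (fun t => (h0 t).differentiableAt) (fun t => (h0 t).deriv) s 0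
  rw [this]
  simp [integral_const_mul]

end

section

open Polynomial Filter Topology
open scoped ContDiff

variable {n : ℕ}
variable {A : Matrix (Fin n) (Fin n) ℝ} {ρ w v : Euc n → ℝ} {φ Φ : ℝ → ℝ}

theorem HasCompactSupport.dirDeriv_iterate {g : Euc n → ℝ} (hc : HasCompactSupport g) (e : Euc n)
    (K : ℕ) : HasCompactSupport ((dirDeriv e)^[K] g) := by
  induction K generalizing g with
  | zero => exact hc
  | succ K ih => exact ih (hc.fderiv_apply ℝ e)

theorem mul_integral_dirDeriv_mul (hw : ContDiff ℝ ∞ w) {g : Euc n → ℝ} (hg : ContDiff ℝ ∞ g)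
    (hc : HasCompactSupport g) (e x : Euc n) (s : ℝ) :
    s * ∫ y, dirDeriv e w (x + s • y) * g y = -∫ y, w (x + s • y) * dirDeriv e g y := by
  have hwc := hw.continuous
  have hgc := hg.continuous
  have hdw := (hw.dirDeriv e).continuous
  have hdg := (hg.dirDeriv e).continuous
  have hds : ∀ y, fderiv ℝ (fun y => w (x + s • y)) y e = s * dirDeriv e w (x + s • y) := fun y =>
    congrFun (dirDeriv_comp_add_smul hw.differentiable_infty x e s) y
  have := integral_mul_fderiv_eq_neg_fderiv_mul_of_integrable (μ := (volume : Measure (Euc n)))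
    (f := fun y => w (x + s • y)) (g := g) (v := e) ?_ ?_ ?_ ?_ ?_
  · simp only [hds, mul_assoc] at this
    rw [integral_const_mul] at this
    exact neg_eq_iff_eq_neg.1 this.symm
  · simp only [hds]
    exact Continuous.integrable_of_hasCompactSupport (by fun_prop) hc.mul_left
  · exact Continuous.integrable_of_hasCompactSupport (hwc.comp (by fun_prop) |>.mul hdg)
      (HasCompactSupport.mul_left (hc.fderiv_apply ℝ e))
  · exact Continuous.integrable_of_hasCompactSupport (by fun_prop) hc.mul_left
  · exact fun y _ => (hw.differentiable_infty _).comp y (by fun_prop)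
  · exact fun y _ => hg.differentiable_infty y

theorem pow_mul_integral_dirDeriv_iterate_mul (hw : ContDiff ℝ ∞ w) {g : Euc n → ℝ}
    (hg : ContDiff ℝ ∞ g) (hc : HasCompactSupport g) (e x : Euc n) (s : ℝ) (K : ℕ) :
    s ^ K * ∫ y, (dirDeriv e)^[K] w (x + s • y) * g y =
      (-1) ^ K * ∫ y, w (x + s • y) * (dirDeriv e)^[K] g y := by
  induction K generalizing w with
  | zero => simp
  | succ K ih =>
    rw [pow_succ', mul_assoc, Function.iterate_succ_apply _ _ w, ih (hw.dirDeriv e),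
      mul_left_comm, mul_integral_dirDeriv_mul hw (hg.dirDeriv_iterate e K)
        (hc.dirDeriv_iterate e K), Function.iterate_succ_apply' _ _ g, pow_succ]
    ring

theorem exists_polynomial_line_of_dirDeriv_iterate_eq_zero {E : Type*} [NormedAddCommGroup E]
    [NormedSpace ℝ E] {w : E → ℝ} (hw : ContDiff ℝ ∞ w) {e : E} {K : ℕ}
    (h : (dirDeriv e)^[K] w = 0) (x : E) :
    ∃ q : ℝ[X], q.natDegree ≤ K ∧ ∀ t : ℝ, w (x + t • e) = q.eval t := by
  induction K generalizing w with
  | zero => exact ⟨0, by simp, fun t => by rw [show w = 0 from h]; simp⟩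
  | succ K ih =>
    obtain ⟨q, hq, hqe⟩ := ih (hw.dirDeriv e) h
    obtain ⟨Q, hQ, hQe⟩ := exists_polynomial_of_hasDerivAt (q := q)
      (f := fun t : ℝ => w (x + t • e)) fun t => by
        rw [← hqe t]; exact hasDerivAt_comp_line hw.differentiable_infty x e t
    exact ⟨Q, by omega, hQe⟩

theorem Polynomial.eq_zero_of_pow_mul_abs_le {F q : ℝ[X]} {K : ℕ} {C : ℝ} (hq : q.natDegree < K)
    (h : ∀ s : ℝ, 0 < s → s ^ K * |F.eval s| ≤ C * q.eval s) : F = 0 := by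
  by_contra hF
  have hdeg : q.degree < (X ^ K * F).degree := by
    rw [degree_mul, degree_X_pow]
    refine lt_of_lt_of_le (degree_le_natDegree.trans_lt (Nat.cast_lt.2 hq)) ?_
    exact le_add_of_nonneg_right (zero_le_degree_iff.2 hF)
  have ht := ((q.div_tendsto_atTop_zero_of_degree_lt _ hdeg).const_mul C).abs
  simp only [mul_zero, abs_zero] at ht
  have hne : ∀ᶠ s : ℝ in atTop, F.eval s ≠ 0 := by
    have := F.eventually_atTop_not_isRoot hF
    exact this
  have h1 : ∀ᶠ s : ℝ in atTop, (1 : ℝ) ≤ |C * (q.eval s / (X ^ K * F).eval s)| := by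
    filter_upwards [hne, eventually_gt_atTop 0] with s hs h0
    have h2 := h s h0
    have h3 : 0 < s ^ K * |F.eval s| := by positivity
    rw [abs_mul, abs_div, eval_mul, eval_pow, eval_X, abs_mul, abs_of_pos (pow_pos h0 K),
      ← mul_div_assoc, le_div_iff₀ h3, one_mul, ← abs_mul]
    exact h2.trans (le_abs_self _)
  exact absurd (ge_of_tendsto ht h1) (by norm_num)

theorem exists_mvPolynomial_of_lines {f : Euc n → ℝ} {N : ℕ}
    (S : Fin n → Set ℝ) (hS : ∀ i, (S i).Infinite)
    (h : ∀ x : Euc n, (∀ i, x i ∈ S i) → ∀ i, ∃ q : ℝ[X], q.natDegree ≤ N ∧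
      ∀ t : ℝ, f (x + t • EuclideanSpace.single i 1) = q.eval t) :
    ∃ T : MvPolynomial (Fin n) ℝ, ∀ x : Euc n, (∀ i, x i ∈ S i) →
      f x = MvPolynomial.eval (fun i => x i) T := by
  obtain ⟨T, hT⟩ := exists_mvPolynomial_of_separately (N := N) S hS
    (fun z => f (WithLp.toLp 2 z)) (by
      intro z hz i
      obtain ⟨q, hq, hqe⟩ := h (WithLp.toLp 2 z) (fun j => hz j trivial) i
      refine ⟨q.comp (X - C (z i)), ?_, fun t _ => ?_⟩
      · refine natDegree_comp_le.trans ?_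
        rw [natDegree_X_sub_C, mul_one]; exact hq
      · rw [eval_comp, eval_sub, eval_X, eval_C, ← hqe]
        congr 1
        ext j
        by_cases hj : j = i
        · subst hj; simp
        · simp [hj])
  exact ⟨T, fun x hx => hT (fun i => x i) fun i _ => hx i⟩

/-- A nonnegative polyharmonic function is a polynomial. -/
theorem IsPolyHarm.exists_mvPolynomial {k : ℕ} (hρ : IsGauge A ρ) (h : IsPolyHarm A k w)
    (hw : ∀ x, 0 ≤ w x) :
    ∃ T : MvPolynomial (Fin n) ℝ, ∀ x : Euc n, w x = MvPolynomial.eval (fun i => x i) T := by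
  set φ₁ : ℝ → ℝ := fun r => Real.smoothTransition (2 - 4 * r) with hφ₁
  set φ₂ : ℝ → ℝ := fun r => Real.smoothTransition (2 - 2 * r) with hφ₂
  have hs₁ : ContDiff ℝ ∞ φ₁ := Real.smoothTransition.contDiff.comp (by fun_prop)
  have hs₂ : ContDiff ℝ ∞ φ₂ := Real.smoothTransition.contDiff.comp (by fun_prop)
  have hz₁' : ∀ r, 1 / 2 ≤ r → φ₁ r = 0 := fun r hr =>
    Real.smoothTransition.zero_of_nonpos (by linarith)
  have hz₁ : ∀ r, 1 ≤ r → φ₁ r = 0 := fun r hr => hz₁' r (by linarith)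
  have hz₂ : ∀ r, 1 ≤ r → φ₂ r = 0 := fun r hr =>
    Real.smoothTransition.zero_of_nonpos (by linarith)
  have ho₂ : ∀ r, r ≤ 1 / 2 → φ₂ r = 1 := fun r hr =>
    Real.smoothTransition.one_of_one_le (by linarith)
  have hn₂ : ∀ r, 0 ≤ φ₂ r := fun r => Real.smoothTransition.nonneg _
  set g : Euc n → ℝ := fun y => φ₁ (ρ y) with hgdef
  have hg : ContDiff ℝ ∞ g := hs₁.comp hρ.contDiff
  have hgc : HasCompactSupport g := by simpa using hρ.hasCompactSupport_mul (fun _ => 1) hz₁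
  have hgpos : 0 < ∫ y, g y := by
    refine hg.continuous.integral_pos_of_hasCompactSupport_nonneg_nonzero hgc
      (fun y => Real.smoothTransition.nonneg _) (x := 0) ?_
    simp [hgdef, hφ₁, hρ.zero, Real.smoothTransition.one_of_one_le]
  have hwc := h.contDiff.continuous
  have hzero : ∀ e, (dirDeriv e)^[2 * k + 1] w = 0 := by
    intro e
    set K := 2 * k + 1 with hK
    funext x
    have hph : ∀ K, IsPolyHarm A k ((dirDeriv e)^[K] w) := fun K => by
      induction K with
      | zero => exact h
      | succ K ih => rw [Function.iterate_succ_apply']; exact ih.dirDeriv e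
    obtain ⟨F, -, hFe⟩ := (hph K).exists_integral_eq_eval hρ hs₁ hz₁ x
    obtain ⟨q, hq, hqe⟩ := h.exists_integral_eq_eval hρ hs₂ hz₂ x
    have hDg := (hg.dirDeriv_iterate e K).continuous
    obtain ⟨C, hC⟩ := (hgc.dirDeriv_iterate e K).exists_bound_of_continuous hDg
    have hsupp : ∀ y, 1 / 2 < ρ y → (dirDeriv e)^[K] g y = 0 := by
      intro y hy
      have : ∀ J, ∀ y, 1 / 2 < ρ y → (dirDeriv e)^[J] g y = 0 := by
        intro J
        induction J with
        | zero => exact fun y hy => hz₁' _ hy.le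
        | succ J ih =>
          intro y hy
          rw [Function.iterate_succ_apply']
          have : (dirDeriv e)^[J] g =ᶠ[𝓝 y] fun _ => 0 := by
            filter_upwards [(hρ.contDiff.continuous.tendsto y).eventually (lt_mem_nhds hy)]
              with z hz using ih z hz
          simp [dirDeriv, this.fderiv_eq]
      exact this K y hy
    have hle : ∀ y, |(dirDeriv e)^[K] g y| ≤ C * φ₂ (ρ y) := by
      intro y
      rcases lt_or_ge (1 / 2) (ρ y) with hy | hy
      · rw [hsupp y hy, abs_zero]
        exact mul_nonneg ((norm_nonneg _).trans (hC y)) (hn₂ _)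
      · rw [ho₂ _ hy, mul_one]; exact hC y
    have hF0 : F = 0 := by
      refine Polynomial.eq_zero_of_pow_mul_abs_le (K := K) (C := C) (q := q) (by omega) ?_
      intro s hs
      have h1 := pow_mul_integral_dirDeriv_iterate_mul h.contDiff hg hgc e x s K
      rw [← hFe s, ← hqe s, ← abs_of_pos (pow_pos hs K), ← abs_mul, h1, abs_mul, abs_pow, abs_neg,
        abs_one, one_pow, one_mul, ← integral_const_mul]
      refine abs_integral_le_integral_abs.trans (integral_mono ?_ ?_ fun y => ?_)
      · refine (Continuous.integrable_of_hasCompactSupport ?_ ?_).abs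
        · exact (hwc.comp (by fun_prop)).mul hDg
        · exact (hgc.dirDeriv_iterate e K).mul_left
      · exact (hρ.integrable_mul (hwc.comp (by fun_prop)) hs₂.continuous hz₂).const_mul _
      · simp only
        rw [abs_mul, abs_of_nonneg (hw _), mul_left_comm]
        exact mul_le_mul_of_nonneg_left (hle y) (hw _)
    have := hFe 0
    rw [hF0] at this
    simp only [zero_smul, add_zero, eval_zero, integral_const_mul] at this
    exact (mul_eq_zero.1 this).resolve_right hgpos.ne'
  obtain ⟨T, hT⟩ := exists_mvPolynomial_of_lines (f := w) (N := 2 * k + 1) (fun _ => Set.univ)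
    (fun _ => Set.infinite_univ) fun x _ i =>
      exists_polynomial_line_of_dirDeriv_iterate_eq_zero h.contDiff (hzero _) x
  exact ⟨T, fun x => hT x fun _ => trivial⟩

end

section

open Polynomial Filter Topology
open scoped ContDiff

variable {n : ℕ}
variable {A : Matrix (Fin n) (Fin n) ℝ} {ρ w v : Euc n → ℝ} {φ Φ : ℝ → ℝ}

theorem IsGauge.exists_kernel (hρ : IsGauge A ρ) : ∃ φ : ℝ → ℝ, ContDiff ℝ ∞ φ ∧
    (∀ r, 1 ≤ r → φ r = 0) ∧ (∀ r, 0 ≤ φ r) ∧ φ 0 = 1 ∧ 0 < ∫ y, φ (ρ y) := by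
  set φ : ℝ → ℝ := fun r => Real.smoothTransition (2 - 2 * r) with hφ
  have hs : ContDiff ℝ ∞ φ := Real.smoothTransition.contDiff.comp (by fun_prop)
  have hz : ∀ r, 1 ≤ r → φ r = 0 := fun r hr =>
    Real.smoothTransition.zero_of_nonpos (by linarith)
  have ho : φ 0 = 1 := Real.smoothTransition.one_of_one_le (by linarith)
  refine ⟨φ, hs, hz, fun r => Real.smoothTransition.nonneg _, ho, ?_⟩
  refine (hs.continuous.comp hρ.contDiff.continuous).integral_pos_of_hasCompactSupport_nonneg_nonzero
    (by simpa using hρ.hasCompactSupport_mul (fun _ => 1) hz)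
    (fun y => Real.smoothTransition.nonneg _) (x := 0) ?_
  simp [hρ.zero, ho]

theorem IsGauge.exists_dirDeriv_bound (hρ : IsGauge A ρ) : ∃ C : ℝ, 0 < C ∧
    ∀ v, ContDiff ℝ ∞ v → ellipticOp A v = 0 → ∀ (x e : Euc n) (h M : ℝ), 0 < h →
      (∀ y ∈ closedBall x h, |v y| ≤ M) → |dirDeriv e v x| ≤ C * ‖e‖ / h * M := by
  obtain ⟨φ, hφ, hφ0, hφn, -, hpos⟩ := hρ.exists_kernel
  set g : Euc n → ℝ := fun y => φ (ρ y) with hgdef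
  have hg : ContDiff ℝ ∞ g := hφ.comp hρ.contDiff
  have hgc : HasCompactSupport g := by simpa using hρ.hasCompactSupport_mul (fun _ => 1) hφ0
  obtain ⟨R₀, hR₀, hK⟩ := hρ.isCompact.isBounded.exists_pos_norm_le
  set c := ∫ y, g y with hc
  set I := ∫ y, ‖fderiv ℝ g y‖ with hI
  have hI0 : 0 ≤ I := integral_nonneg fun _ => norm_nonneg _
  have hIi : Integrable fun y => ‖fderiv ℝ g y‖ :=
    (((hg.fderiv_right (m := ∞) (by simp)).continuous).integrable_of_hasCompactSupport
      (hgc.fderiv ℝ)).norm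
  refine ⟨R₀ * I / c + 1, by positivity, ?_⟩
  intro v hv hLv x e h M hh hM
  have hM0 : 0 ≤ M := (abs_nonneg _).trans (hM x (mem_closedBall_self hh.le))
  have hs : 0 < h / R₀ := by positivity
  set s := h / R₀ with hsdef
  have h1 := mul_integral_dirDeriv_mul hv hg hgc e x s
  have hLd : ellipticOp A (dirDeriv e v) = 0 := by
    rw [ellipticOp_dirDeriv hv, hLv]; funext x; simp [dirDeriv]
  have h2 := hρ.integral_eq (hv.dirDeriv e) hLd hφ hφ0 x s
  rw [h2] at h1
  have hoff : ∀ y, ¬ ρ y ≤ 1 → fderiv ℝ g y = 0 := by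
    intro y hy
    have : g =ᶠ[𝓝 y] fun _ => 0 := by
      filter_upwards [(hρ.contDiff.continuous.tendsto y).eventually (lt_mem_nhds (not_le.1 hy))]
        with z hz using hφ0 _ hz.le
    simp [this.fderiv_eq]
  have h3 : |∫ y, v (x + s • y) * dirDeriv e g y| ≤ M * ‖e‖ * I := by
    rw [hI, ← integral_const_mul]
    refine abs_integral_le_integral_abs.trans (integral_mono ?_ (hIi.const_mul _) fun y => ?_)
    · refine (Continuous.integrable_of_hasCompactSupport ?_ ?_).abs
      · exact (hv.continuous.comp (by fun_prop)).mul (hg.dirDeriv e).continuous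
      · exact HasCompactSupport.mul_left (hgc.fderiv_apply ℝ e)
    · simp only [dirDeriv]
      by_cases hy : ρ y ≤ 1
      · have h4 : |v (x + s • y)| ≤ M := hM _ (by
          rw [mem_closedBall, dist_eq_norm, add_sub_cancel_left, norm_smul, Real.norm_eq_abs,
            abs_of_pos hs]
          calc s * ‖y‖ ≤ s * R₀ := by gcongr; exact hK y hy
            _ = h := by rw [hsdef]; field_simp)
        have h5 : |fderiv ℝ g y e| ≤ ‖fderiv ℝ g y‖ * ‖e‖ := (fderiv ℝ g y).le_opNorm e
        rw [abs_mul, mul_assoc, mul_comm ‖e‖]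
        gcongr
      · simp [hoff y hy]
  have h6 : s * c * |dirDeriv e v x| ≤ M * ‖e‖ * I := by
    refine le_trans (le_of_eq ?_) h3
    rw [← abs_neg (∫ y, v (x + s • y) * dirDeriv e g y), ← h1, abs_mul, abs_mul, abs_of_pos hs,
      abs_of_pos hpos]
    ring
  have h7 : |dirDeriv e v x| ≤ M * ‖e‖ * I / (s * c) := by
    rw [le_div_iff₀ (by positivity)]; linarith
  refine h7.trans ?_
  have : M * ‖e‖ * I / (s * c) = (R₀ * I / c) * ‖e‖ / h * M := by
    rw [hsdef]; field_simp
  rw [this]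
  gcongr
  linarith

/-- Iterated directional derivatives of harmonic functions grow slower than any geometric sequence
times factorials. -/
theorem IsGauge.exists_foldr_dirDeriv_bound (hρ : IsGauge A ρ) (hv : ContDiff ℝ ∞ v)
    (hLv : ellipticOp A v = 0) (S b : ℝ) {r : ℝ} (hr : 0 < r) :
    ∃ C : ℝ, 0 ≤ C ∧ ∀ l : List (Euc n), (∀ e ∈ l, ‖e‖ ≤ b) → ∀ x, ‖x‖ ≤ S →
      |l.foldr dirDeriv v x| ≤ C * l.length.factorial * r ^ l.length := by
  obtain ⟨C₀, hC₀, hb⟩ := hρ.exists_dirDeriv_bound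
  set b' := max b 1 with hb'
  have hb0 : 0 < b' := lt_max_of_lt_right one_pos
  have hfold : ∀ l : List (Euc n), ContDiff ℝ ∞ (l.foldr dirDeriv v) ∧
      ellipticOp A (l.foldr dirDeriv v) = 0 := by
    intro l
    induction l with
    | nil => exact ⟨hv, hLv⟩
    | cons e l ih =>
      refine ⟨ih.1.dirDeriv e, ?_⟩
      rw [List.foldr_cons, ellipticOp_dirDeriv ih.1, ih.2]; funext x; simp [dirDeriv]
  have hiter : ∀ l : List (Euc n), (∀ e ∈ l, ‖e‖ ≤ b') → ∀ (x : Euc n) (h M : ℝ), 0 < h →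
      (∀ y ∈ closedBall x (l.length * h), |v y| ≤ M) →
      |l.foldr dirDeriv v x| ≤ (C₀ * b' / h) ^ l.length * M := by
    intro l
    induction l with
    | nil => intro _ x h M hh hM; simpa using hM x (by simp)
    | cons e l ih =>
      intro hl x h M hh hM
      have hM0 : 0 ≤ M := (abs_nonneg _).trans (hM x (mem_closedBall_self (by positivity)))
      rw [List.foldr_cons, List.length_cons]
      have h1 := hb _ (hfold l).1 (hfold l).2 x e h ((C₀ * b' / h) ^ l.length * M) hh (by
        intro y hy
        refine ih (fun e he => hl e (List.mem_cons_of_mem _ he)) y h M hh fun z hz => hM z ?_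
        rw [mem_closedBall] at *
        refine (dist_triangle z y x).trans ?_
        rw [List.length_cons]; push_cast
        linarith)
      refine h1.trans ?_
      rw [pow_succ', mul_assoc (C₀ * b' / h)]
      have := hl e List.mem_cons_self
      gcongr
  set R := C₀ * b' * Real.exp 1 / r with hR
  have hR0 : 0 < R := by positivity
  obtain ⟨M, hM⟩ := (isCompact_closedBall (0 : Euc n) (S + R)).exists_bound_of_continuousOn
    hv.continuous.continuousOn
  refine ⟨max M 0, le_max_right _ _, fun l hl x hx => ?_⟩
  have hM' : ∀ y ∈ closedBall x R, |v y| ≤ max M 0 := fun y hy => by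
    refine (hM y ?_).trans (le_max_left _ _)
    rw [mem_closedBall] at *
    rw [dist_zero_right] at *
    have := norm_add_le (y - x) x
    rw [sub_add_cancel, ← dist_eq_norm] at this
    linarith
  rcases Nat.eq_zero_or_pos l.length with h0 | h0
  · have : l = [] := List.length_eq_zero_iff.1 h0
    subst this
    simpa using hM' x (mem_closedBall_self hR0.le)
  · have hN : (0 : ℝ) < l.length := Nat.cast_pos.2 h0
    have := hiter l (fun e he => (hl e he).trans (le_max_left _ _)) x (R / l.length) (max M 0)
      (by positivity) (by rw [mul_div_cancel₀ _ hN.ne']; exact hM')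
    refine this.trans ?_
    have h2 : C₀ * b' / (R / l.length) = l.length * r / Real.exp 1 := by
      rw [hR]; field_simp
    have h3 := Real.pow_div_factorial_le_exp (l.length : ℝ) hN.le l.length
    rw [div_le_iff₀ (by positivity)] at h3
    rw [h2, div_pow, mul_pow, Real.exp_one_pow, mul_comm, mul_assoc]
    refine mul_le_mul_of_nonneg_left ?_ (le_max_right _ _)
    rw [div_le_iff₀ (Real.exp_pos _)]
    have : 0 ≤ r ^ l.length := by positivity
    nlinarith

theorem foldr_replicate_dirDeriv (e : Euc n) (k : ℕ) (f : Euc n → ℝ) :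
    (List.replicate k e).foldr dirDeriv f = (dirDeriv e)^[k] f := by
  induction k with
  | zero => rfl
  | succ k ih => rw [List.replicate_succ, List.foldr_cons, ih, Function.iterate_succ_apply']

theorem IsGauge.exists_dirDeriv_iterate_bound (hρ : IsGauge A ρ) (hv : ContDiff ℝ ∞ v)
    (hLv : ellipticOp A v = 0) (S b : ℝ) {r : ℝ} (hr : 0 < r) :
    ∃ C : ℝ, 0 ≤ C ∧ ∀ d e : Euc n, ‖d‖ ≤ b → ‖e‖ ≤ b → ∀ x, ‖x‖ ≤ S → ∀ j k : ℕ,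
      |(dirDeriv d)^[j] ((dirDeriv e)^[k] v) x| ≤ C * (j + k).factorial * r ^ (j + k) := by
  obtain ⟨C, hC, h⟩ := hρ.exists_foldr_dirDeriv_bound hv hLv S b hr
  refine ⟨C, hC, fun d e hd he x hx j k => ?_⟩
  have := h (List.replicate j d ++ List.replicate k e) (by
    intro a ha
    rcases List.mem_append.1 ha with ha | ha
    · rw [(List.mem_replicate.1 ha).2]; exact hd
    · rw [(List.mem_replicate.1 ha).2]; exact he) x hx
  simpa [List.foldr_append, foldr_replicate_dirDeriv] using this

section taylor

variable {E : Type*} [NormedAddCommGroup E] [NormedSpace ℝ E] {f : E → ℝ}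

theorem iteratedDeriv_comp_line (hf : ContDiff ℝ ∞ f) (x e : E) (k : ℕ) :
    iteratedDeriv k (fun t : ℝ => f (x + t • e)) = fun t => (dirDeriv e)^[k] f (x + t • e) := by
  induction k with
  | zero => simp
  | succ k ih =>
    rw [iteratedDeriv_succ, ih, Function.iterate_succ_apply']
    funext t
    exact (hasDerivAt_comp_line (hf.dirDeriv_iterate e k).differentiable_infty x e t).deriv

theorem dirDeriv_iterate_smul (hf : ContDiff ℝ ∞ f) (s : ℝ) (e : E) (k : ℕ) :
    (dirDeriv (s • e))^[k] f = fun x => s ^ k * (dirDeriv e)^[k] f x := by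
  induction k with
  | zero => simp
  | succ k ih =>
    rw [Function.iterate_succ_apply', ih,
      dirDeriv_const_mul _ (hf.dirDeriv_iterate e k).differentiable_infty,
      Function.iterate_succ_apply']
    funext x
    simp [dirDeriv]; ring

theorem hasSum_taylor_of_bound (hf : ContDiff ℝ ∞ f) {x e : E} {C r : ℝ} (hr0 : 0 ≤ r) (hr : r < 1)
    (hb : ∀ k, ∀ t ∈ Set.Icc (0 : ℝ) 1,
      |(dirDeriv e)^[k] f (x + t • e)| ≤ C * k.factorial * r ^ k) :
    HasSum (fun k => (dirDeriv e)^[k] f x / k.factorial) (f (x + e)) := by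
  have hC : 0 ≤ C := by simpa using (abs_nonneg _).trans (hb 0 0 (by simp))
  have hcoef : ∀ k, ‖(dirDeriv e)^[k] f x / k.factorial‖ ≤ C * r ^ k := by
    intro k
    have h1 := hb k 0 (by simp)
    simp only [zero_smul, add_zero] at h1
    have h2 : (0 : ℝ) < k.factorial := by positivity
    rw [Real.norm_eq_abs, abs_div, abs_of_pos h2, div_le_iff₀ h2]
    linarith
  have hsum : Summable fun k => ‖(dirDeriv e)^[k] f x / k.factorial‖ :=
    Summable.of_nonneg_of_le (fun _ => norm_nonneg _) hcoef
      ((summable_geometric_of_lt_one hr0 hr).mul_left C)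
  rw [hasSum_iff_tendsto_nat_of_summable_norm hsum, ← tendsto_add_atTop_iff_nat 1]
  have hg : ContDiff ℝ ∞ fun t : ℝ => f (x + t • e) := hf.comp (by fun_prop)
  have hrem : ∀ N : ℕ, ‖f (x + e) - ∑ k ∈ Finset.range (N + 1),
      (dirDeriv e)^[k] f x / k.factorial‖ ≤ C * ((N + 1 : ℕ) * r ^ (N + 1)) := by
    intro N
    have hw : ∀ k, ∀ t ∈ Set.Icc (0 : ℝ) 1,
        iteratedDerivWithin k (fun t : ℝ => f (x + t • e)) (Set.Icc 0 1) t =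
          (dirDeriv e)^[k] f (x + t • e) := fun k t ht => by
      rw [iteratedDerivWithin_eq_iteratedDeriv (uniqueDiffOn_Icc one_pos)
        (hg.contDiffAt.of_le (by exact_mod_cast le_top)) ht, iteratedDeriv_comp_line hf]
    have := taylor_mean_remainder_bound (f := fun t : ℝ => f (x + t • e)) (n := N)
      (C := C * (N + 1).factorial * r ^ (N + 1)) zero_le_one
      (hg.of_le (by exact_mod_cast le_top)).contDiffOn (Set.right_mem_Icc.2 zero_le_one)
      (fun t ht => by rw [hw _ t ht]; exact hb _ t ht)
    rw [taylor_within_apply] at this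
    simp only [one_smul, sub_zero, one_pow, mul_one, smul_eq_mul] at this
    have hs : ∑ k ∈ Finset.range (N + 1), (k.factorial : ℝ)⁻¹ *
        iteratedDerivWithin k (fun t : ℝ => f (x + t • e)) (Set.Icc 0 1) 0 =
        ∑ k ∈ Finset.range (N + 1), (dirDeriv e)^[k] f x / k.factorial :=
      Finset.sum_congr rfl fun k _ => by rw [hw k 0 (by simp), div_eq_inv_mul]; simp
    rw [hs] at this
    refine this.trans (le_of_eq ?_)
    rw [Nat.factorial_succ]
    push_cast
    field_simp
  have hz : Tendsto (fun N : ℕ => C * ((N + 1 : ℕ) * r ^ (N + 1))) atTop (𝓝 0) := by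
    have := (tendsto_self_mul_const_pow_of_lt_one hr0 hr).const_mul C
    rw [mul_zero] at this
    exact (tendsto_add_atTop_iff_nat 1).2 this
  rw [tendsto_iff_norm_sub_tendsto_zero]
  refine squeeze_zero (fun _ => norm_nonneg _) (fun N => ?_) hz
  rw [norm_sub_rev]
  exact hrem N

end taylor

end

section

open Polynomial Filter Topology
open scoped ContDiff

variable {n : ℕ}
variable {A : Matrix (Fin n) (Fin n) ℝ} {ρ w v : Euc n → ℝ} {φ Φ : ℝ → ℝ}

/-- The algebra of continuous functions whose restriction to every line extends to an entire
function. -/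
def entireAlg (E : Type*) [NormedAddCommGroup E] [NormedSpace ℝ E] : Subalgebra ℝ (E → ℝ) where
  carrier := {f | Continuous f ∧ ∀ x d : E, ∃ F : ℂ → ℂ, Differentiable ℂ F ∧
    ∀ s : ℝ, F s = f (x + s • d)}
  mul_mem' := by
    rintro f g ⟨hf, hf'⟩ ⟨hg, hg'⟩
    refine ⟨hf.mul hg, fun x d => ?_⟩
    obtain ⟨F, hF, hFe⟩ := hf' x d
    obtain ⟨G, hG, hGe⟩ := hg' x d
    exact ⟨fun z => F z * G z, hF.mul hG, fun s => by simp [hFe, hGe]⟩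
  add_mem' := by
    rintro f g ⟨hf, hf'⟩ ⟨hg, hg'⟩
    refine ⟨hf.add hg, fun x d => ?_⟩
    obtain ⟨F, hF, hFe⟩ := hf' x d
    obtain ⟨G, hG, hGe⟩ := hg' x d
    exact ⟨fun z => F z + G z, hF.add hG, fun s => by simp [hFe, hGe]⟩
  algebraMap_mem' r := ⟨continuous_const, fun _ _ => ⟨fun _ => r, differentiable_const _,
    fun _ => rfl⟩⟩

/-- An entire function is determined by its values on the reals near the origin. -/
theorem eq_of_eventually_ofReal_eq {F G : ℂ → ℂ} (hF : Differentiable ℂ F)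
    (hG : Differentiable ℂ G) (h : ∀ᶠ s : ℝ in 𝓝 0, F s = G s) : F = G := by
  have h4 : Tendsto (fun s : ℝ => (s : ℂ)) (𝓝[≠] 0) (𝓝[≠] 0) := by
    refine tendsto_nhdsWithin_iff.2 ⟨?_, ?_⟩
    · exact tendsto_nhdsWithin_of_tendsto_nhds (Complex.continuous_ofReal.tendsto' 0 0 rfl)
    · filter_upwards [self_mem_nhdsWithin] with s hs
      simpa using hs
  exact AnalyticOnNhd.eq_of_frequently_eq (fun z _ => hF.analyticAt z) (fun z _ => hG.analyticAt z)
    (h4.frequently (h.filter_mono nhdsWithin_le_nhds).frequently)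

section entireAlg

variable {E : Type*} [NormedAddCommGroup E] [NormedSpace ℝ E] {f : E → ℝ}

theorem eq_zero_of_mem_entireAlg (hf : f ∈ entireAlg E) {x : E} (hx : f =ᶠ[𝓝 x] 0) : f = 0 := by
  funext y
  obtain ⟨F, hF, hFe⟩ := hf.2 x (y - x)
  have h1 : ∀ᶠ s : ℝ in 𝓝 0, f (x + s • (y - x)) = 0 := by
    have : Tendsto (fun s : ℝ => x + s • (y - x)) (𝓝 0) (𝓝 x) := by
      have : Continuous fun s : ℝ => x + s • (y - x) := by fun_prop
      simpa using this.tendsto 0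
    exact this.eventually hx
  have h5 := congrFun (eq_of_eventually_ofReal_eq hF (differentiable_const 0)
    (h1.mono fun s hs => by rw [hFe, hs, Complex.ofReal_zero])) 1
  have := hFe 1
  rw [Complex.ofReal_one, h5] at this
  simpa using this.symm

end entireAlg

theorem IsGauge.hasSum_taylor (hρ : IsGauge A ρ) (hv : ContDiff ℝ ∞ v)
    (hLv : ellipticOp A v = 0) (x e : Euc n) :
    HasSum (fun k => (dirDeriv e)^[k] v x / k.factorial) (v (x + e)) := by
  obtain ⟨C, hC, h⟩ := hρ.exists_dirDeriv_iterate_bound hv hLv (‖x‖ + ‖e‖) ‖e‖ (r := 1 / 2)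
    (by norm_num)
  refine hasSum_taylor_of_bound hv (C := C) (r := 1 / 2) (by norm_num) (by norm_num) ?_
  intro k t ht
  have := h e e le_rfl le_rfl (x + t • e) ?_ 0 k
  · simpa using this
  · refine (norm_add_le _ _).trans ?_
    rw [norm_smul, Real.norm_eq_abs, abs_of_nonneg ht.1]
    gcongr
    exact mul_le_of_le_one_left (norm_nonneg _) ht.2

theorem ellipticOp_dirDeriv_iterate (hv : ContDiff ℝ ∞ v) (hLv : ellipticOp A v = 0) (e : Euc n)
    (k : ℕ) : ellipticOp A ((dirDeriv e)^[k] v) = 0 := by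
  induction k with
  | zero => exact hLv
  | succ k ih =>
    rw [Function.iterate_succ_apply', ellipticOp_dirDeriv (hv.dirDeriv_iterate e k), ih]
    funext x; simp [dirDeriv]

/-- The Taylor coefficients of a harmonic function in direction `e` extend to entire functions on
every line, with locally uniform bounds. -/
theorem IsGauge.exists_entire_coeff (hρ : IsGauge A ρ) (hv : ContDiff ℝ ∞ v)
    (hLv : ellipticOp A v = 0) (x e d : Euc n) :
    ∃ F : ℕ → ℂ → ℂ, (∀ k, Differentiable ℂ (F k)) ∧
      (∀ k (s : ℝ), F k s = ((dirDeriv e)^[k] v (x + s • d) / k.factorial : ℝ)) ∧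
      ∀ T r : ℝ, 0 < r → ∃ C, 0 ≤ C ∧ ∀ k z, ‖z‖ ≤ T → ‖F k z‖ ≤ C * r ^ k := by
  set a : ℕ → ℕ → ℝ := fun k j =>
    (dirDeriv d)^[j] ((dirDeriv e)^[k] v) x / (j.factorial * k.factorial) with ha
  have hbound : ∀ T r : ℝ, 0 < r → ∃ C, 0 ≤ C ∧ ∀ k j (z : ℂ), ‖z‖ ≤ T →
      ‖(a k j : ℂ) * z ^ j‖ ≤ C * r ^ k * (1 / 2) ^ j := by
    intro T r hr
    set r' := min (r / 2) (1 / (4 * (|T| + 1))) with hr'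
    have hr0 : 0 < r' := by positivity
    obtain ⟨C, hC, h⟩ := hρ.exists_dirDeriv_iterate_bound hv hLv ‖x‖ (max ‖d‖ ‖e‖) hr0
    refine ⟨C, hC, fun k j z hz => ?_⟩
    have h1 := h d e (le_max_left _ _) (le_max_right _ _) x le_rfl j k
    have hfac : ((j + k).factorial : ℝ) ≤ 2 ^ (j + k) * (j.factorial * k.factorial) := by
      rw [← Nat.add_choose_mul_factorial_mul_factorial j k]
      push_cast
      rw [mul_assoc]
      gcongr
      exact_mod_cast Nat.choose_le_two_pow _ _
    have hpos : (0 : ℝ) < j.factorial * k.factorial := by positivity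
    have h2 : |a k j| ≤ C * (2 * r') ^ (j + k) := by
      rw [ha, abs_div, abs_of_pos hpos, div_le_iff₀ hpos]
      refine h1.trans ?_
      calc C * (j + k).factorial * r' ^ (j + k)
          ≤ C * (2 ^ (j + k) * (j.factorial * k.factorial)) * r' ^ (j + k) := by gcongr
        _ = _ := by rw [mul_pow]; ring
    rw [norm_mul, norm_pow, Complex.norm_real, Real.norm_eq_abs]
    have h3 : 2 * r' ≤ r := by linarith [min_le_left (r / 2) (1 / (4 * (|T| + 1)))]
    have h4 : 2 * r' * ‖z‖ ≤ 1 / 2 := by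
      have h5 : r' ≤ 1 / (4 * (|T| + 1)) := min_le_right _ _
      have h6 : 0 < |T| + 1 := by positivity
      rw [le_div_iff₀ (by positivity)] at h5
      have h7 : ‖z‖ ≤ |T| + 1 := hz.trans ((le_abs_self T).trans (by linarith))
      nlinarith
    calc |a k j| * ‖z‖ ^ j ≤ C * (2 * r') ^ (j + k) * ‖z‖ ^ j := by gcongr
      _ = C * (2 * r') ^ k * (2 * r' * ‖z‖) ^ j := by rw [pow_add, mul_pow _ ‖z‖]; ring
      _ ≤ _ := by gcongr
  have hgeo : Summable fun j : ℕ => ((1 : ℝ) / 2) ^ j :=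
    summable_geometric_of_lt_one (by norm_num) (by norm_num)
  refine ⟨fun k z => ∑' j, (a k j : ℂ) * z ^ j, fun k z => ?_, fun k s => ?_, fun T r hr => ?_⟩
  · obtain ⟨C, hC, h⟩ := hbound (‖z‖ + 1) 1 one_pos
    have := Complex.differentiableOn_tsum_of_summable_norm (u := fun j => C * 1 ^ k * (1 / 2) ^ j)
      (F := fun j z => (a k j : ℂ) * z ^ j) (hgeo.mul_left _)
      (fun j => by fun_prop) (isOpen_ball (x := (0 : ℂ)) (ε := ‖z‖ + 1))
      (fun j w hw => h k j w (mem_ball_zero_iff.1 hw).le)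
    exact this.differentiableAt (isOpen_ball.mem_nhds (by simp))
  · have := hρ.hasSum_taylor (hv.dirDeriv_iterate e k) (ellipticOp_dirDeriv_iterate hv hLv e k) x
      (s • d)
    have h2 := (Complex.hasSum_ofReal.2 (this.div_const (k.factorial : ℝ)))
    rw [← h2.tsum_eq]
    refine tsum_congr fun j => ?_
    rw [dirDeriv_iterate_smul (hv.dirDeriv_iterate e k), ha]
    push_cast
    ring
  · obtain ⟨C, hC, h⟩ := hbound T r hr
    refine ⟨C * 2, by positivity, fun k z hz => ?_⟩
    refine tsum_of_norm_bounded ?_ fun j => h k j z hz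
    rw [show C * 2 * r ^ k = C * r ^ k * 2 by ring]
    exact hasSum_geometric_two.mul_left (C * r ^ k)

theorem IsGauge.mem_entireAlg (hρ : IsGauge A ρ) (hv : ContDiff ℝ ∞ v)
    (hLv : ellipticOp A v = 0) : v ∈ entireAlg (Euc n) := by
  refine ⟨hv.continuous, fun x d => ?_⟩
  obtain ⟨F, hF, hFe, -⟩ := hρ.exists_entire_coeff hv hLv x d d
  exact ⟨F 0, hF 0, fun s => by simp [hFe]⟩

theorem IsGauge.eq_zero_of_eventually_nonneg (hρ : IsGauge A ρ) (hv : ContDiff ℝ ∞ v)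
    (hLv : ellipticOp A v = 0) {x : Euc n} (hx : v x = 0) (h : ∀ᶠ y in 𝓝 x, 0 ≤ v y) : v = 0 := by
  refine eq_zero_of_mem_entireAlg (hρ.mem_entireAlg hv hLv) (x := x) ?_
  obtain ⟨φ, hφ, hφ0, hφn, hφ1, hpos⟩ := hρ.exists_kernel
  obtain ⟨R₀, hR₀, hK⟩ := hρ.isCompact.isBounded.exists_pos_norm_le
  obtain ⟨ε, hε, hball⟩ := Metric.eventually_nhds_iff_ball.1 h
  set s := ε / (2 * R₀) with hs
  have hs0 : 0 < s := by positivity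
  have h1 := hρ.integral_eq hv hLv hφ hφ0 x s
  rw [hx, zero_mul] at h1
  have hcont : Continuous fun y => v (x + s • y) * φ (ρ y) :=
    (hv.continuous.comp (by fun_prop)).mul (hφ.continuous.comp hρ.contDiff.continuous)
  have hcs := hρ.hasCompactSupport_mul (fun y => v (x + s • y)) hφ0
  have hnn : ∀ y, 0 ≤ v (x + s • y) * φ (ρ y) := by
    intro y
    by_cases hy : ρ y ≤ 1
    · refine mul_nonneg (hball _ ?_) (hφn _)
      rw [mem_ball, dist_eq_norm, add_sub_cancel_left, norm_smul, Real.norm_eq_abs, abs_of_pos hs0]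
      calc s * ‖y‖ ≤ s * R₀ := by gcongr; exact hK y hy
        _ = ε / 2 := by rw [hs]; field_simp
        _ < ε := by linarith
    · rw [IsGauge.comp_eq_zero hφ0 hy, mul_zero]
  have hz : ∀ y, v (x + s • y) * φ (ρ y) = 0 := by
    intro y
    by_contra hy
    exact (hcont.integral_pos_of_hasCompactSupport_nonneg_nonzero hcs hnn hy).ne' h1
  have hφpos : ∀ᶠ y in 𝓝 (0 : Euc n), 0 < φ (ρ y) := by
    have hc : Continuous fun y => φ (ρ y) := hφ.continuous.comp hρ.contDiff.continuous
    exact (hc.tendsto 0).eventually (lt_mem_nhds (by simp [hρ.zero, hφ1]))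
  have ht : Tendsto (fun y : Euc n => s⁻¹ • (y - x)) (𝓝 x) (𝓝 0) := by
    have : Continuous fun y : Euc n => s⁻¹ • (y - x) := by fun_prop
    simpa using this.tendsto x
  filter_upwards [ht.eventually hφpos] with y hy
  have := hz (s⁻¹ • (y - x))
  rw [smul_inv_smul₀ hs0.ne', add_sub_cancel] at this
  exact (mul_eq_zero.1 this).resolve_right (ne_of_gt hy)

/-- A nonzero harmonic function changes sign near each of its zeros. -/
theorem IsGauge.exists_neg (hρ : IsGauge A ρ) (hv : ContDiff ℝ ∞ v)
    (hLv : ellipticOp A v = 0) (hne : v ≠ 0) {x : Euc n} (hx : v x = 0) :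
    ∃ᶠ y in 𝓝 x, v y < 0 := by
  by_contra h
  rw [not_frequently] at h
  exact hne (hρ.eq_zero_of_eventually_nonneg hv hLv hx (h.mono fun y hy => not_lt.1 hy))

theorem IsGauge.exists_pos (hρ : IsGauge A ρ) (hv : ContDiff ℝ ∞ v)
    (hLv : ellipticOp A v = 0) (hne : v ≠ 0) {x : Euc n} (hx : v x = 0) :
    ∃ᶠ y in 𝓝 x, 0 < v y := by
  have h1 : (fun x => (-1) * v x) = -v := by funext x; simp
  have h2 : ellipticOp A (-v) = 0 := by
    rw [← h1, ellipticOp_const_mul _ hv, hLv]; funext x; simp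
  refine (hρ.exists_neg hv.neg h2 (neg_ne_zero.2 hne) (x := x) (by simp [hx])).mono ?_
  intro y hy
  simpa using hy

end

section

open Polynomial Filter Topology
open scoped ContDiff

section entireAlgDomain

variable {E : Type*} [NormedAddCommGroup E] [NormedSpace ℝ E]

theorem entireAlg_ext_of_eventuallyEq {f g : entireAlg E} {x : E} (h : f.1 =ᶠ[𝓝 x] g.1) :
    f = g := by
  have := eq_zero_of_mem_entireAlg (f - g).2 (x := x) <| by
    filter_upwards [h] with y hy
    simpa [sub_eq_zero] using hy
  exact sub_eq_zero.1 (Subtype.ext this)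

theorem frequently_ne_zero_of_mem_entireAlg {f : entireAlg E} (hf : f ≠ 0) (x : E) :
    ∃ᶠ y in 𝓝 x, f.1 y ≠ 0 := by
  intro h
  refine hf (entireAlg_ext_of_eventuallyEq (x := x) ?_)
  filter_upwards [h] with y hy
  exact not_not.1 hy

instance : IsDomain (entireAlg E) := by
  have : Nontrivial (entireAlg E) := ⟨0, 1, fun h => by
    simpa using congrFun (congrArg Subtype.val h) 0⟩
  have : NoZeroDivisors (entireAlg E) := ⟨fun {f g} h => by
    by_contra! hfg
    obtain ⟨x, hx⟩ := (frequently_ne_zero_of_mem_entireAlg hfg.1 0).exists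
    have h1 : ∀ᶠ y in 𝓝 x, f.1 y ≠ 0 := (f.2.1.tendsto x).eventually_ne hx
    obtain ⟨y, hy, hy'⟩ := ((frequently_ne_zero_of_mem_entireAlg hfg.2 x).and_eventually h1).exists
    have := congrFun (congrArg Subtype.val h) y
    exact mul_ne_zero hy' hy this⟩
  exact NoZeroDivisors.to_isDomain _

end entireAlgDomain

variable {m : ℕ}

/-- Evaluation of a real polynomial at the complex point `x + z d`. -/
def lineEval (x d : Fin m → ℝ) (z : ℂ) : MvPolynomial (Fin m) ℝ →+* ℂ :=
  MvPolynomial.eval₂Hom Complex.ofRealHom fun k => x k + z * d k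

theorem lineEval_ofReal (x d : Fin m → ℝ) (s : ℝ) (a : MvPolynomial (Fin m) ℝ) :
    lineEval x d s a = (MvPolynomial.eval (x + s • d) a : ℝ) := by
  induction a using MvPolynomial.induction_on with
  | C r => simp [lineEval]
  | add p q hp hq => rw [map_add, map_add, hp, hq, Complex.ofReal_add]
  | mul_X p i hp => rw [map_mul, map_mul, hp]; simp [lineEval]

theorem differentiable_lineEval (x d : Fin m → ℝ) (a : MvPolynomial (Fin m) ℝ) :
    Differentiable ℂ fun z => lineEval x d z a := by
  induction a using MvPolynomial.induction_on with
  | C r => simp [lineEval]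
  | add p q hp hq =>
    simp only [map_add]
    exact hp.fun_add hq
  | mul_X p i hp =>
    simp only [map_mul]
    refine hp.mul ?_
    simp only [lineEval, MvPolynomial.coe_eval₂Hom, MvPolynomial.eval₂_X]
    fun_prop

theorem exists_norm_lineEval_le (a : MvPolynomial (Fin m) ℝ) :
    ∃ N : ℕ, ∀ x d : Fin m → ℝ, ∃ C : ℝ, 0 ≤ C ∧ ∀ z, ‖lineEval x d z a‖ ≤ C * (1 + ‖z‖) ^ N := by
  induction a using MvPolynomial.induction_on with
  | C r => exact ⟨0, fun x d => ⟨|r|, abs_nonneg _, fun z => by simp [lineEval]⟩⟩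
  | add p q hp hq =>
    obtain ⟨N, hN⟩ := hp
    obtain ⟨M, hM⟩ := hq
    refine ⟨max N M, fun x d => ?_⟩
    obtain ⟨C, hC, h⟩ := hN x d
    obtain ⟨D, hD, h'⟩ := hM x d
    refine ⟨C + D, by positivity, fun z => ?_⟩
    have h1 : (1 : ℝ) ≤ 1 + ‖z‖ := by linarith [norm_nonneg z]
    rw [map_add, add_mul]
    refine (norm_add_le _ _).trans (add_le_add ((h z).trans ?_) ((h' z).trans ?_))
    · gcongr; exact le_max_left _ _
    · gcongr; exact le_max_right _ _
  | mul_X p i hp =>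
    obtain ⟨N, hN⟩ := hp
    refine ⟨N + 1, fun x d => ?_⟩
    obtain ⟨C, hC, h⟩ := hN x d
    refine ⟨C * (|x i| + |d i|), by positivity, fun z => ?_⟩
    rw [map_mul, norm_mul, pow_succ]
    have h2 : ‖lineEval x d z (MvPolynomial.X i)‖ ≤ (|x i| + |d i|) * (1 + ‖z‖) := by
      simp only [lineEval, MvPolynomial.coe_eval₂Hom, MvPolynomial.eval₂_X]
      refine (norm_add_le _ _).trans ?_
      rw [norm_mul, Complex.norm_real, Complex.norm_real, Real.norm_eq_abs, Real.norm_eq_abs]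
      nlinarith [norm_nonneg z, abs_nonneg (x i), abs_nonneg (d i),
        mul_nonneg (norm_nonneg z) (abs_nonneg (x i))]
    calc _ ≤ C * (1 + ‖z‖) ^ N * ((|x i| + |d i|) * (1 + ‖z‖)) := by gcongr; exact h z
      _ = _ := by ring

/-- Polynomial functions as elements of `entireAlg`. -/
def polyHom (m : ℕ) : MvPolynomial (Fin m) ℝ →+* entireAlg (Fin m → ℝ) where
  toFun a := ⟨fun x => MvPolynomial.eval x a, MvPolynomial.continuous_eval a, fun x d =>
    ⟨fun z => lineEval x d z a, differentiable_lineEval x d a, fun s => lineEval_ofReal x d s a⟩⟩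
  map_one' := Subtype.ext <| by funext x; simp
  map_mul' a b := Subtype.ext <| by funext x; simp
  map_zero' := Subtype.ext <| by funext x; simp
  map_add' a b := Subtype.ext <| by funext x; simp

instance : Algebra (MvPolynomial (Fin m) ℝ) (entireAlg (Fin m → ℝ)) := (polyHom m).toAlgebra

theorem algebraMap_entireAlg_apply (a : MvPolynomial (Fin m) ℝ) (x : Fin m → ℝ) :
    (algebraMap (MvPolynomial (Fin m) ℝ) (entireAlg (Fin m → ℝ)) a).1 x = MvPolynomial.eval x a :=
  rfl

theorem algebraMap_entireAlg_injective :
    Function.Injective (algebraMap (MvPolynomial (Fin m) ℝ) (entireAlg (Fin m → ℝ))) := by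
  intro a b h
  refine MvPolynomial.funext fun x => ?_
  rw [← algebraMap_entireAlg_apply, h, algebraMap_entireAlg_apply]

/-- A root of a monic polynomial, written homogeneously, is bounded by the coefficients. -/
theorem norm_le_of_homogeneous_root {𝕜 : Type*} [NormedField 𝕜] (d : ℕ) (a : ℕ → 𝕜) (x y : 𝕜)
    (h : x ^ d + ∑ i ∈ Finset.range d, a i * x ^ i * y ^ (d - i) = 0) :
    ‖x‖ ≤ (1 + ∑ i ∈ Finset.range d, ‖a i‖) * ‖y‖ := by
  by_contra! hlt
  set S := ∑ i ∈ Finset.range d, ‖a i‖ with hS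
  have hS0 : 0 ≤ S := Finset.sum_nonneg fun _ _ => norm_nonneg _
  have hyx : ‖y‖ ≤ ‖x‖ := by nlinarith [norm_nonneg y]
  have hx : 0 < ‖x‖ := lt_of_le_of_lt (by positivity) hlt
  have h1 : ‖x‖ ^ d ≤ S * ‖y‖ * ‖x‖ ^ (d - 1) := by
    rw [← norm_pow, eq_neg_of_add_eq_zero_left h, norm_neg, hS, Finset.sum_mul, Finset.sum_mul]
    refine norm_sum_le_of_le _ fun i hi => ?_
    have hi := Finset.mem_range.1 hi
    rw [norm_mul, norm_mul, norm_pow, norm_pow, mul_assoc, mul_assoc]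
    refine mul_le_mul_of_nonneg_left ?_ (norm_nonneg _)
    rw [show d - i = (d - i - 1) + 1 by omega, pow_succ, show d - 1 = i + (d - i - 1) by omega,
      pow_add]
    calc ‖x‖ ^ i * (‖y‖ ^ (d - i - 1) * ‖y‖) ≤ ‖x‖ ^ i * (‖x‖ ^ (d - i - 1) * ‖y‖) := by gcongr
      _ = _ := by ring
  rcases Nat.eq_zero_or_pos d with rfl | hd
  · simp at hS; simp [hS] at h1; linarith
  · rw [show d = d - 1 + 1 by omega, pow_succ, Nat.add_sub_cancel, mul_comm (S * _)] at h1
    have := le_of_mul_le_mul_left h1 (by positivity)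
    nlinarith [norm_nonneg y]

end

section

open Polynomial Filter Topology
open scoped ContDiff

variable {m : ℕ}

/-- The ring of polynomials is integrally closed among quotients of functions in `entireAlg`. -/
theorem exists_eq_mul_of_homogeneous_root {f g : entireAlg (Fin m → ℝ)} (hg : g ≠ 0) (d : ℕ)
    (a : ℕ → MvPolynomial (Fin m) ℝ)
    (h : f ^ d + ∑ i ∈ Finset.range d, algebraMap _ _ (a i) * f ^ i * g ^ (d - i) = 0) :
    ∃ T, f = g * algebraMap (MvPolynomial (Fin m) ℝ) _ T := by
  have hpt : ∀ x, f.1 x ^ d +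
      ∑ i ∈ Finset.range d, MvPolynomial.eval x (a i) * f.1 x ^ i * g.1 x ^ (d - i) = 0 := by
    intro x
    have := congrFun (congrArg Subtype.val h) x
    simpa [Finset.sum_apply, algebraMap_entireAlg_apply] using this
  choose N hN using fun i => exists_norm_lineEval_le (a i)
  set M := ∑ i ∈ Finset.range d, N i with hM
  have hline : ∀ x e, g.1 x ≠ 0 → ∃ q : ℝ[X], q.natDegree ≤ M ∧
      ∀ s : ℝ, f.1 (x + s • e) = g.1 (x + s • e) * q.eval s := by
    intro x e hx
    obtain ⟨F, hF, hFe⟩ := f.2.2 x e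
    obtain ⟨G, hG, hGe⟩ := g.2.2 x e
    choose C hC hCb using fun i => hN i x e
    have hroot : ∀ z : ℂ, F z ^ d +
        ∑ i ∈ Finset.range d, lineEval x e z (a i) * F z ^ i * G z ^ (d - i) = 0 := by
      have hd : Differentiable ℂ fun z => F z ^ d +
          ∑ i ∈ Finset.range d, lineEval x e z (a i) * F z ^ i * G z ^ (d - i) :=
        (hF.pow d).fun_add (Differentiable.fun_sum fun i _ =>
          ((differentiable_lineEval x e (a i)).mul (hF.pow i)).mul (hG.pow _))
      intro z
      refine congrFun (eq_of_eventually_ofReal_eq hd (differentiable_const 0)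
        (Eventually.of_forall fun s => ?_)) z
      have := hpt (x + s • e)
      rw [hFe, hGe]
      simp only [lineEval_ofReal]
      exact_mod_cast this
    refine exists_real_polynomial_mul_eq hF hG hFe hGe (s₀ := 0) (by simpa using hx)
      (C := 1 + ∑ i ∈ Finset.range d, C i) (N := M) fun z => ?_
    refine (norm_le_of_homogeneous_root d _ _ _ (hroot z)).trans ?_
    gcongr
    have h1 : (1 : ℝ) ≤ 1 + ‖z‖ := by linarith [norm_nonneg z]
    rw [add_mul, one_mul, Finset.sum_mul]
    refine add_le_add (one_le_pow₀ h1) (Finset.sum_le_sum fun i hi => (hCb i z).trans ?_)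
    refine mul_le_mul_of_nonneg_left (pow_le_pow_right₀ h1 ?_) (hC i)
    exact Finset.single_le_sum (f := N) (fun _ _ => Nat.zero_le _) hi
  obtain ⟨x₀, hx₀⟩ := (frequently_ne_zero_of_mem_entireAlg hg 0).exists
  have hnear : ∀ᶠ y in 𝓝 x₀, g.1 y ≠ 0 := (g.2.1.tendsto x₀).eventually_ne hx₀
  obtain ⟨ε, hε, hball⟩ := Metric.eventually_nhds_iff_ball.1 hnear
  have hbox : ∀ z ∈ Set.univ.pi fun i => ball (x₀ i) ε, g.1 z ≠ 0 := by
    intro z hz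
    exact hball z (by rwa [ball_pi _ hε])
  have hinf : ∀ i, (ball (x₀ i) ε).Infinite := by
    intro i
    rw [Real.ball_eq_Ioo]
    exact Set.Ioo_infinite (by linarith)
  obtain ⟨T, hT⟩ := exists_mvPolynomial_of_separately (N := M) (fun i => ball (x₀ i) ε) hinf
    (fun z => f.1 z / g.1 z) (by
      intro z hz i
      obtain ⟨q, hq, hqe⟩ := hline z (Pi.single i 1) (hbox z hz)
      refine ⟨q.comp (X - C (z i)), ?_, fun t ht => ?_⟩
      · rwa [natDegree_comp, natDegree_X_sub_C, mul_one]
      · have hupd : Function.update z i t = z + (t - z i) • Pi.single i 1 := by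
          funext j
          by_cases hj : j = i
          · subst hj; simp
          · simp [hj]
        have hmem : Function.update z i t ∈ Set.univ.pi fun i => ball (x₀ i) ε := by
          intro j _
          by_cases hj : j = i
          · subst hj; simpa using ht
          · simpa [hj] using hz j (Set.mem_univ j)
        have hne := hbox _ hmem
        rw [hupd] at hne ⊢
        rw [hqe, mul_div_cancel_left₀ _ hne]
        simp)
  refine ⟨T, entireAlg_ext_of_eventuallyEq (x := x₀) ?_⟩
  filter_upwards [ball_mem_nhds x₀ hε] with y hy
  have h1 := hT y (by rwa [← ball_pi _ hε])
  rw [div_eq_iff (hball y hy)] at h1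
  change f.1 y = g.1 y * MvPolynomial.eval y T
  rw [h1, mul_comm]

variable {K : Type*} [Field K] [Algebra (entireAlg (Fin m → ℝ)) K]
  [IsFractionRing (entireAlg (Fin m → ℝ)) K] [Algebra (MvPolynomial (Fin m) ℝ) K]
  [IsScalarTower (MvPolynomial (Fin m) ℝ) (entireAlg (Fin m → ℝ)) K]

theorem mem_range_of_isIntegral_entireAlg {h : K} (hh : IsIntegral (MvPolynomial (Fin m) ℝ) h) :
    ∃ T, algebraMap (MvPolynomial (Fin m) ℝ) K T = h := by
  obtain ⟨p, hp, hroot⟩ := hh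
  obtain ⟨f, g, hg, rfl⟩ := IsFractionRing.div_surjective (A := entireAlg (Fin m → ℝ)) h
  have hg0 : g ≠ 0 := nonZeroDivisors.ne_zero hg
  have hgK : algebraMap (entireAlg (Fin m → ℝ)) K g ≠ 0 :=
    (map_ne_zero_iff _ (IsFractionRing.injective _ K)).2 hg0
  obtain ⟨T, hT⟩ := exists_eq_mul_of_homogeneous_root (f := f) hg0 p.natDegree p.coeff (by
    apply IsFractionRing.injective (entireAlg (Fin m → ℝ)) K
    rw [eval₂_eq_sum_range, Finset.sum_range_succ, coeff_natDegree, hp.leadingCoeff, map_one,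
      one_mul] at hroot
    have h2 := congrArg (· * algebraMap (entireAlg (Fin m → ℝ)) K g ^ p.natDegree) hroot
    simp only [add_mul, zero_mul, Finset.sum_mul] at h2
    rw [map_zero, ← h2, add_comm, map_add, map_sum, map_pow, div_pow,
      div_mul_cancel₀ _ (pow_ne_zero _ hgK)]
    congr 1
    refine Finset.sum_congr rfl fun i hi => ?_
    have hi := Finset.mem_range.1 hi
    rw [map_mul, map_mul, map_pow, map_pow, ← IsScalarTower.algebraMap_apply]
    rw [← pow_mul_pow_sub _ hi.le, div_pow]
    field_simp)
  refine ⟨T, ?_⟩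
  rw [hT, map_mul, mul_div_cancel_left₀ _ hgK, ← IsScalarTower.algebraMap_apply]

/-- Gauss's lemma: monic factors over `K` of a monic polynomial over the polynomial ring are
defined over the polynomial ring. -/
theorem exists_monic_lift_of_dvd {U : (MvPolynomial (Fin m) ℝ)[X]} (hU : U.Monic) {D : K[X]}
    (hD : D.Monic) (hd : D ∣ U.map (algebraMap _ K)) :
    ∃ P : (MvPolynomial (Fin m) ℝ)[X], P.Monic ∧ P.map (algebraMap _ K) = D ∧
      P.natDegree = D.natDegree := by
  have h1 := integralClosure.mem_lifts_of_monic_of_dvd_map K hU hD hd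
  have h2 : D ∈ lifts (algebraMap (MvPolynomial (Fin m) ℝ) K) := by
    rw [lifts_iff_coeff_lifts] at h1 ⊢
    intro k
    obtain ⟨c, hc⟩ := h1 k
    obtain ⟨T, hT⟩ := mem_range_of_isIntegral_entireAlg (K := K) c.2
    exact ⟨T, hT.trans hc⟩
  obtain ⟨P, hP, hPd, hPm⟩ := lifts_and_natDegree_eq_and_monic h2 hD
  exact ⟨P, hPm, hP, hPd⟩

end

section

open Polynomial Filter Topology
open scoped ContDiff

variable {m : ℕ}

theorem X_pow_succ_modByMonic {R : Type*} [CommRing R] {Q : R[X]} (hQ : Q.Monic)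
    (hd : 0 < Q.natDegree) (k : ℕ) :
    X ^ (k + 1) %ₘ Q = X * (X ^ k %ₘ Q) - C ((X ^ k %ₘ Q).coeff (Q.natDegree - 1)) * Q := by
  nontriviality R
  set τ := X ^ k %ₘ Q with hτ
  refine (div_modByMonic_unique (X * (X ^ k /ₘ Q) + C (τ.coeff (Q.natDegree - 1))) _ hQ
    ⟨?_, ?_⟩).2
  · have := modByMonic_add_div (X ^ k : R[X]) Q
    linear_combination X * this
  · have hτd : τ.degree < Q.natDegree := by
      rw [← degree_eq_natDegree hQ.ne_zero]; exact degree_modByMonic_lt _ hQ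
    rw [degree_eq_natDegree hQ.ne_zero, degree_lt_iff_coeff_zero]
    intro j hj
    rw [degree_lt_iff_coeff_zero] at hτd
    obtain ⟨i, rfl⟩ : ∃ i, j = i + 1 := ⟨j - 1, by omega⟩
    rw [coeff_sub, coeff_X_mul, coeff_C_mul]
    rcases hj.lt_or_eq with h | h
    · rw [hτd i (by omega), coeff_eq_zero_of_natDegree_lt h, mul_zero, sub_zero]
    · rw [← h, hQ.coeff_natDegree, mul_one, h, Nat.add_sub_cancel, sub_self]

theorem norm_coeff_X_pow_modByMonic_le {R 𝕜 : Type*} [CommRing R] [NormedField 𝕜] (φ : R →+* 𝕜)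
    {Q : R[X]} (hQ : Q.Monic) {B : ℝ} (hB : ∀ j, ‖φ (Q.coeff j)‖ ≤ B) (k j : ℕ) :
    ‖φ ((X ^ k %ₘ Q).coeff j)‖ ≤ (1 + B) ^ k := by
  have hB0 : 0 ≤ B := (norm_nonneg _).trans (hB 0)
  rcases Nat.eq_zero_or_pos Q.natDegree with hd | hd
  · rw [hQ.natDegree_eq_zero.1 hd, modByMonic_one, coeff_zero, map_zero, norm_zero]
    positivity
  induction k generalizing j with
  | zero =>
    have : Nontrivial R := RingHom.domain_nontrivial φ
    rw [pow_zero, pow_zero, (modByMonic_eq_self_iff hQ).2, coeff_one]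
    · split_ifs <;> simp
    · rw [degree_one, degree_eq_natDegree hQ.ne_zero]
      exact_mod_cast hd
  | succ k ih =>
    rw [X_pow_succ_modByMonic hQ hd, coeff_sub, coeff_C_mul, map_sub, map_mul]
    have h1 : ‖φ ((X * (X ^ k %ₘ Q)).coeff j)‖ ≤ (1 + B) ^ k := by
      cases j with
      | zero => simp; positivity
      | succ j => rw [coeff_X_mul]; exact ih j
    refine (norm_sub_le _ _).trans ?_
    rw [norm_mul, pow_succ, mul_add, mul_one]
    exact add_le_add h1 (mul_le_mul (ih _) (hB j) (norm_nonneg _) (by positivity))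

theorem eval_X_pow_modByMonic {R 𝕜 : Type*} [CommRing R] [Field 𝕜] (φ : R →+* 𝕜)
    {Q : R[X]} {t : 𝕜} (ht : Q.eval₂ φ t = 0) (k : ℕ) :
    (X ^ k %ₘ Q).eval₂ φ t = t ^ k := by
  have := congrArg (eval₂ φ t) (modByMonic_add_div (X ^ k : R[X]) Q)
  rwa [eval₂_add, eval₂_mul, ht, zero_mul, add_zero, eval₂_pow, eval₂_X] at this

/-- Evaluation at a point, as a ring homomorphism on `entireAlg`. -/
def evalHom (x : Fin m → ℝ) : entireAlg (Fin m → ℝ) →+* ℝ :=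
  (Pi.evalRingHom (fun _ => ℝ) x).comp (entireAlg (Fin m → ℝ)).val.toRingHom

theorem evalHom_apply (x : Fin m → ℝ) (f : entireAlg (Fin m → ℝ)) : evalHom x f = f.1 x := rfl

/-- The function `V x t = ∑ k, c k x * t ^ k` is entire in `t`, with coefficients that are entire
on lines, locally uniformly. -/
structure IsEntireSeries (V : (Fin m → ℝ) → ℝ → ℝ) (c : ℕ → (Fin m → ℝ) → ℝ) : Prop where
  hasSum : ∀ x t, HasSum (fun k => c k x * t ^ k) (V x t)
  continuous : ∀ k, Continuous (c k)
  bound : ∀ S r : ℝ, 0 < r → ∃ C, 0 ≤ C ∧ ∀ k x, ‖x‖ ≤ S → |c k x| ≤ C * r ^ k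
  entire : ∀ x d, ∃ F : ℕ → ℂ → ℂ, (∀ k, Differentiable ℂ (F k)) ∧
      (∀ k (s : ℝ), F k s = (c k (x + s • d) : ℝ)) ∧
      ∀ T r : ℝ, 0 < r → ∃ C, 0 ≤ C ∧ ∀ k z, ‖z‖ ≤ T → ‖F k z‖ ≤ C * r ^ k

variable {V : (Fin m → ℝ) → ℝ → ℝ} {c : ℕ → (Fin m → ℝ) → ℝ}

theorem exists_bound_of_continuous {X R 𝕜 : Type*} [TopologicalSpace X] [Semiring R]
    [NormedRing 𝕜] {Q : R[X]} (φ : X → R →+* 𝕜)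
    (hφ : ∀ a, Continuous fun x => φ x a) {K : Set X} (hK : IsCompact K) :
    ∃ B, 0 ≤ B ∧ ∀ x ∈ K, ∀ j, ‖φ x (Q.coeff j)‖ ≤ B := by
  choose b hb using fun j => hK.exists_bound_of_continuousOn (hφ (Q.coeff j)).continuousOn
  refine ⟨∑ j ∈ Finset.range (Q.natDegree + 1), |b j|, Finset.sum_nonneg fun _ _ => abs_nonneg _,
    fun x hx j => ?_⟩
  by_cases hj : j ≤ Q.natDegree
  · exact ((hb j x hx).trans (le_abs_self _)).trans
      (Finset.single_le_sum (f := fun j => |b j|) (fun _ _ => abs_nonneg _)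
        (Finset.mem_range.2 (by omega)))
  · rw [coeff_eq_zero_of_natDegree_lt (by omega), map_zero, norm_zero]
    exact Finset.sum_nonneg fun _ _ => abs_nonneg _

theorem summable_const_mul_half_pow (C : ℝ) : Summable fun k : ℕ => C * (1 / 2 : ℝ) ^ k :=
  (summable_geometric_of_lt_one (by norm_num) (by norm_num)).mul_left _

theorem norm_mul_le_half_pow {𝕜 : Type*} [NormedField 𝕜] {a b : 𝕜} {C B : ℝ} {k : ℕ} (hC : 0 ≤ C)
    (hB : 0 ≤ B) (ha : ‖a‖ ≤ C * (1 / (2 * (1 + B))) ^ k) (hb : ‖b‖ ≤ (1 + B) ^ k) :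
    ‖a * b‖ ≤ C * (1 / 2) ^ k := by
  rw [norm_mul]
  calc _ ≤ C * (1 / (2 * (1 + B))) ^ k * (1 + B) ^ k := by gcongr
    _ = C * (1 / (2 * (1 + B)) * (1 + B)) ^ k := by rw [mul_pow]; ring
    _ = _ := by congr 2; field_simp

theorem IsEntireSeries.summable_coeff (hV : IsEntireSeries V c) {Q : (MvPolynomial (Fin m) ℝ)[X]}
    (hQ : Q.Monic) (S : ℝ) : ∃ C, ∀ x, ‖x‖ ≤ S → ∀ j k,
      ‖c k x * MvPolynomial.eval x ((X ^ k %ₘ Q).coeff j)‖ ≤ C * (1 / 2) ^ k := by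
  obtain ⟨B, hB, hBb⟩ := exists_bound_of_continuous (Q := Q) (fun x => MvPolynomial.eval x)
    (fun a => MvPolynomial.continuous_eval a) (isCompact_closedBall (0 : Fin m → ℝ) S)
  obtain ⟨C, hC, h⟩ := hV.bound S (1 / (2 * (1 + B))) (by positivity)
  exact ⟨C, fun x hx j k => norm_mul_le_half_pow hC hB (h k x hx)
    (norm_coeff_X_pow_modByMonic_le _ hQ (hBb x (by simpa using hx)) k j)⟩

theorem IsEntireSeries.coeff_mem_entireAlg (hV : IsEntireSeries V c)
    {Q : (MvPolynomial (Fin m) ℝ)[X]} (hQ : Q.Monic) (j : ℕ) :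
    (fun x => ∑' k, c k x * MvPolynomial.eval x ((X ^ k %ₘ Q).coeff j)) ∈
      entireAlg (Fin m → ℝ) := by
  refine ⟨continuous_iff_continuousAt.2 fun x => ?_, fun x d => ?_⟩
  · obtain ⟨C, hC⟩ := hV.summable_coeff hQ (‖x‖ + 1)
    have : ContinuousOn (fun x => ∑' k, c k x * MvPolynomial.eval x ((X ^ k %ₘ Q).coeff j))
        (ball 0 (‖x‖ + 1)) :=
      continuousOn_tsum
        (fun k => ((hV.continuous k).mul (MvPolynomial.continuous_eval _)).continuousOn)
        (summable_const_mul_half_pow C) fun k y hy => hC y (mem_ball_zero_iff.1 hy).le j k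
    exact this.continuousAt (isOpen_ball.mem_nhds (by simp))
  · obtain ⟨F, hF, hFe, hFb⟩ := hV.entire x d
    refine ⟨fun z => ∑' k, F k z * lineEval x d z ((X ^ k %ₘ Q).coeff j), fun z => ?_, fun s => ?_⟩
    · obtain ⟨B, hB, hBb⟩ := exists_bound_of_continuous (Q := Q) (fun z => lineEval x d z)
        (fun a => (differentiable_lineEval x d a).continuous)
        (isCompact_closedBall (0 : ℂ) (‖z‖ + 1))
      obtain ⟨C, hC, h⟩ := hFb (‖z‖ + 1) (1 / (2 * (1 + B))) (by positivity)
      have := Complex.differentiableOn_tsum_of_summable_norm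
        (F := fun k z => F k z * lineEval x d z ((X ^ k %ₘ Q).coeff j))
        (summable_const_mul_half_pow C)
        (fun k => ((hF k).mul (differentiable_lineEval x d _)).differentiableOn)
        (isOpen_ball (x := (0 : ℂ)) (ε := ‖z‖ + 1)) (fun k w hw => by
          have hw := ball_subset_closedBall hw
          exact norm_mul_le_half_pow hC hB (h k w (by simpa using hw))
            (norm_coeff_X_pow_modByMonic_le _ hQ (hBb w hw) k j))
      exact this.differentiableAt (isOpen_ball.mem_nhds (by simp))
    · rw [Complex.ofReal_tsum]
      refine tsum_congr fun k => ?_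
      rw [hFe, lineEval_ofReal, Complex.ofReal_mul]

/-- Weierstrass division: the remainder of `V` modulo a monic polynomial. -/
theorem IsEntireSeries.exists_remainder (hV : IsEntireSeries V c)
    {Q : (MvPolynomial (Fin m) ℝ)[X]} (hQ : Q.Monic) :
    ∃ r : (entireAlg (Fin m → ℝ))[X], r.degree < Q.natDegree ∧
      ∀ x t, Q.eval₂ (MvPolynomial.eval x) t = 0 → r.eval₂ (evalHom x) t = V x t := by
  set r : Fin Q.natDegree → entireAlg (Fin m → ℝ) := fun j => ⟨_, hV.coeff_mem_entireAlg hQ j⟩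
    with hr
  refine ⟨∑ j : Fin Q.natDegree, C (r j) * X ^ (j : ℕ), degree_sum_fin_lt r, fun x t ht => ?_⟩
  obtain ⟨C, hC⟩ := hV.summable_coeff hQ ‖x‖
  have hs : ∀ j : Fin Q.natDegree, HasSum
      (fun k => c k x * MvPolynomial.eval x ((X ^ k %ₘ Q).coeff j) * t ^ (j : ℕ))
      ((∑' k, c k x * MvPolynomial.eval x ((X ^ k %ₘ Q).coeff j)) * t ^ (j : ℕ)) := fun j =>
    (Summable.of_norm_bounded (summable_const_mul_half_pow C)
      fun k => hC x le_rfl j k).hasSum.mul_right _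
  have h1 := hasSum_sum fun j (_ : j ∈ Finset.univ) => hs j
  have hQ1 : Q ≠ 1 := by
    rintro rfl
    simp at ht
  have key : ∀ k, c k x * t ^ k = ∑ j : Fin Q.natDegree,
      c k x * MvPolynomial.eval x ((X ^ k %ₘ Q).coeff j) * t ^ (j : ℕ) := by
    intro k
    rw [← eval_X_pow_modByMonic (MvPolynomial.eval x) ht k,
      eval₂_eq_sum_range' _ (natDegree_modByMonic_lt _ hQ hQ1), Finset.mul_sum,
      Finset.sum_range]
    simp only [mul_assoc]
  have h2 := hV.hasSum x t
  rw [funext key] at h2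
  rw [h2.unique h1, eval₂_finsetSum]
  refine Finset.sum_congr rfl fun j _ => ?_
  simp [evalHom_apply, hr]

end

section

open Polynomial Filter Topology
open scoped ContDiff

variable {m : ℕ}

/-- Evaluation of a polynomial in `m + 1` variables, written as a polynomial in the last one. -/
abbrev bivEval (U : (MvPolynomial (Fin m) ℝ)[X]) (x : Fin m → ℝ) (t : ℝ) : ℝ :=
  U.eval₂ (MvPolynomial.eval x) t

theorem continuous_bivEval (U : (MvPolynomial (Fin m) ℝ)[X]) :
    Continuous fun p : (Fin m → ℝ) × ℝ => bivEval U p.1 p.2 := by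
  simp only [bivEval, eval₂_eq_sum_range]
  exact continuous_finsetSum _ fun i _ =>
    ((MvPolynomial.continuous_eval _).comp continuous_fst).mul (continuous_snd.pow i)

theorem hasDerivAt_bivEval (U : (MvPolynomial (Fin m) ℝ)[X]) (x : Fin m → ℝ) (t : ℝ) :
    HasDerivAt (bivEval U x) (bivEval (derivative U) x t) t := by
  have : bivEval U x = fun t => (U.map (MvPolynomial.eval x)).eval t := by
    funext t; rw [bivEval, eval₂_eq_eval_map]
  rw [this, bivEval, eval₂_eq_eval_map, ← derivative_map]
  exact Polynomial.hasDerivAt _ t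

theorem eventually_bivEval_ne_zero {U : (MvPolynomial (Fin m) ℝ)[X]} (hU : U.Monic)
    (x : Fin m → ℝ) (t : ℝ) : ∀ᶠ s in 𝓝[≠] t, bivEval U x s ≠ 0 := by
  have h0 : U.map (MvPolynomial.eval x) ≠ 0 := (hU.map _).ne_zero
  have hfin := (U.map (MvPolynomial.eval x)).roots.toFinset.finite_toSet
  have h1 : ∀ᶠ s in 𝓝[≠] t, s ∈ ((U.map (MvPolynomial.eval x)).roots.toFinset : Set ℝ)ᶜ := by
    have := (hfin.subset (Set.sdiff_subset (t := {t}))).isClosed.isOpen_compl.mem_nhds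
      (x := t) (by simp)
    filter_upwards [nhdsWithin_le_nhds this, self_mem_nhdsWithin] with s hs hst hs'
    exact hs ⟨hs', hst⟩
  filter_upwards [h1] with s hs h
  refine hs ?_
  simpa [h0, bivEval, eval₂_eq_eval_map] using h

theorem eval₂_evalHom_map (P : (MvPolynomial (Fin m) ℝ)[X]) (x : Fin m → ℝ) (t : ℝ) :
    (P.map (algebraMap _ (entireAlg (Fin m → ℝ)))).eval₂ (evalHom x) t = bivEval P x t := by
  rw [eval₂_map]
  rfl

/-- A continuous function taking both signs near each of its zeros. -/
structure IsOscillating (V : (Fin m → ℝ) → ℝ → ℝ) : Prop where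
  continuous : Continuous fun p : (Fin m → ℝ) × ℝ => V p.1 p.2
  neg : ∀ x t, V x t = 0 → ∃ᶠ p in 𝓝 (x, t), V p.1 p.2 < 0
  pos : ∀ x t, V x t = 0 → ∃ᶠ p in 𝓝 (x, t), 0 < V p.1 p.2

variable {V : (Fin m → ℝ) → ℝ → ℝ} {c : ℕ → (Fin m → ℝ) → ℝ}

theorem IsOscillating.fun_neg (hV : IsOscillating V) : IsOscillating fun x t => -V x t :=
  ⟨hV.continuous.neg, fun x t h => by simpa using hV.pos x t (by simpa using h),
    fun x t h => by simpa using hV.neg x t (by simpa using h)⟩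

theorem IsOscillating.continuous_left (hV : IsOscillating V) (t : ℝ) :
    Continuous fun x => V x t :=
  hV.continuous.comp (Continuous.prodMk_left t)

theorem IsOscillating.continuous_right (hV : IsOscillating V) (x : Fin m → ℝ) :
    Continuous (V x) :=
  hV.continuous.comp (Continuous.prodMk_right x)

theorem IsOscillating.frequently_mul_neg (hV : IsOscillating V) {x : Fin m → ℝ} {t a : ℝ}
    (h : V x t = 0) (ha : a ≠ 0) : ∃ᶠ p in 𝓝 (x, t), a * V p.1 p.2 < 0 := by
  rcases ha.lt_or_gt with ha | ha
  · exact (hV.pos x t h).mono fun p hp => mul_neg_of_neg_of_pos ha hp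
  · exact (hV.neg x t h).mono fun p hp => mul_neg_of_pos_of_neg ha hp

theorem exists_zero_of_mul_neg {f : ℝ → ℝ} (hf : Continuous f) {s t : ℝ} (h : f s * f t < 0) :
    ∃ a ∈ Set.uIcc s t, f a = 0 := by
  have h0 : (0 : ℝ) ∈ Set.uIcc (f s) (f t) := by
    rw [Set.mem_uIcc]
    rcases mul_neg_iff.1 h with h | h
    · exact Or.inr ⟨h.2.le, h.1.le⟩
    · exact Or.inl ⟨h.1.le, h.2.le⟩
  exact intermediate_value_uIcc hf.continuousOn h0

/-- A polynomial vanishing on the generic part of the zero set of an oscillating function vanishes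
on all of it. -/
theorem IsOscillating.bivEval_eq_zero_of_mul (hV : IsOscillating V)
    {U P : (MvPolynomial (Fin m) ℝ)[X]} (hU : U.Monic)
    (hUV : ∀ x t, V x t = 0 → bivEval U x t = 0) {g : entireAlg (Fin m → ℝ)} (hg : g ≠ 0)
    (hP : ∀ x t, V x t = 0 → g.1 x * bivEval P x t = 0) {x : Fin m → ℝ} {t : ℝ}
    (h : V x t = 0) : bivEval P x t = 0 := by
  by_contra hne
  have h1 : ∀ᶠ p in 𝓝 (x, t), bivEval P p.1 p.2 ≠ 0 :=
    ((continuous_bivEval P).tendsto (x, t)).eventually_ne hne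
  obtain ⟨ε, hε, hball⟩ := Metric.eventually_nhds_iff_ball.1 h1
  obtain ⟨t₁, ht₁, ht₁b⟩ := ((eventually_bivEval_ne_zero hU x t).and
    (nhdsWithin_le_nhds (ball_mem_nhds t hε))).exists
  have hV₁ : V x t₁ ≠ 0 := fun h => ht₁ (hUV _ _ h)
  have h2 : ∀ᶠ y in 𝓝 x, 0 < V x t₁ * V y t₁ :=
    ((continuous_const.mul (hV.continuous_left t₁)).tendsto x).eventually
      (lt_mem_nhds (mul_self_pos.2 hV₁))
  have h3 : ∀ᶠ p : (Fin m → ℝ) × ℝ in 𝓝 (x, t),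
      (0 < V x t₁ * V p.1 t₁ ∧ p.1 ∈ ball x ε) ∧ p.2 ∈ ball t ε := by
    rw [nhds_prod_eq]
    exact (h2.and (ball_mem_nhds x hε)).prod_mk (ball_mem_nhds t hε)
  obtain ⟨⟨x₁, t₂⟩, hlt, ⟨hpos, hx₁⟩, ht₂⟩ :=
    ((hV.frequently_mul_neg h hV₁).and_eventually h3).exists
  have h4 : V x₁ t₁ * V x₁ t₂ < 0 := by
    have h5 : (V x t₁ * V x₁ t₁) * (V x t₁ * V x₁ t₂) < 0 := mul_neg_of_pos_of_neg hpos hlt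
    have h6 : 0 < V x t₁ * V x t₁ := mul_self_pos.2 hV₁
    by_contra! h7
    nlinarith [mul_nonneg h6.le h7]
  have h5 : ∀ᶠ y in 𝓝 x₁, V y t₁ * V y t₂ < 0 ∧ y ∈ ball x ε :=
    ((((hV.continuous_left t₁).mul (hV.continuous_left t₂)).tendsto x₁).eventually
      (gt_mem_nhds h4)).and (isOpen_ball.mem_nhds hx₁)
  obtain ⟨y, hgy, hy, hyb⟩ := ((frequently_ne_zero_of_mem_entireAlg hg x₁).and_eventually h5).exists
  obtain ⟨s, hs, hs0⟩ := exists_zero_of_mul_neg (hV.continuous_right y) hy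
  have hsb : s ∈ ball t ε := (convex_ball t ε).ordConnected.uIcc_subset ht₁b ht₂ hs
  refine mul_ne_zero hgy (hball (y, s) ?_) (hP y s hs0)
  rw [← ball_prod_same]
  exact ⟨hyb, hsb⟩

/-- `U` is a monic polynomial of least degree vanishing on the zero set of `V`. -/
structure IsMinimalMonic (V : (Fin m → ℝ) → ℝ → ℝ) (U : (MvPolynomial (Fin m) ℝ)[X]) : Prop where
  monic : U.Monic
  eq_zero : ∀ x t, V x t = 0 → bivEval U x t = 0
  le : ∀ P : (MvPolynomial (Fin m) ℝ)[X], P.Monic → (∀ x t, V x t = 0 → bivEval P x t = 0) →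
    U.natDegree ≤ P.natDegree

theorem exists_isMinimalMonic {U₀ : (MvPolynomial (Fin m) ℝ)[X]} (hU : U₀.Monic)
    (h : ∀ x t, V x t = 0 → bivEval U₀ x t = 0) : ∃ U, IsMinimalMonic V U := by
  let s : Set (MvPolynomial (Fin m) ℝ)[X] :=
    {U | U.Monic ∧ ∀ x t, V x t = 0 → bivEval U x t = 0}
  have hs : s.Nonempty := ⟨U₀, hU, h⟩
  have hmem := Function.argminOn_mem (fun U : (MvPolynomial (Fin m) ℝ)[X] => U.natDegree) s hs
  exact ⟨_, hmem.1, hmem.2, fun P hP hPV => Function.argminOn_le _ s (a := P) ⟨hP, hPV⟩⟩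

variable {K : Type*} [Field K] [Algebra (entireAlg (Fin m → ℝ)) K]
  [IsFractionRing (entireAlg (Fin m → ℝ)) K] [Algebra (MvPolynomial (Fin m) ℝ) K]
  [IsScalarTower (MvPolynomial (Fin m) ℝ) (entireAlg (Fin m → ℝ)) K]

theorem exists_clear_denominators {R F : Type*} [CommRing R] [IsDomain R] [Field F] [Algebra R F]
    [IsFractionRing R F] (a b : F[X]) : ∃ (g : R) (α β : R[X]), g ≠ 0 ∧
      α.map (algebraMap R F) = C (algebraMap R F g) * a ∧
      β.map (algebraMap R F) = C (algebraMap R F g) * b := by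
  obtain ⟨g, hg, h⟩ := IsLocalization.integerNormalization_spec (nonZeroDivisors R) a
  obtain ⟨g', hg', h'⟩ := IsLocalization.integerNormalization_spec (nonZeroDivisors R) b
  refine ⟨g * g', C g' * IsLocalization.integerNormalization (nonZeroDivisors R) a,
    C g * IsLocalization.integerNormalization (nonZeroDivisors R) b,
    nonZeroDivisors.ne_zero (mul_mem hg hg'), ?_, ?_⟩
  · rw [Polynomial.map_mul, h, map_C, ← algebraMap_smul F g a, smul_eq_C_mul, map_mul, C_mul]
    ring
  · rw [Polynomial.map_mul, h', map_C, ← algebraMap_smul F g' b, smul_eq_C_mul, map_mul, C_mul]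
    ring

/-- A polynomial with coefficients in `entireAlg` that vanishes on the zero set of `V` is divisible
by the minimal monic polynomial. -/
theorem IsMinimalMonic.dvd_map {U : (MvPolynomial (Fin m) ℝ)[X]} (hU : IsMinimalMonic V U)
    (hV : IsOscillating V) {r : (entireAlg (Fin m → ℝ))[X]}
    (hr : ∀ x t, V x t = 0 → r.eval₂ (evalHom x) t = 0) :
    U.map (algebraMap _ K) ∣ r.map (algebraMap _ K) := by
  classical
  set U' := U.map (algebraMap _ K) with hU'
  set r' := r.map (algebraMap _ K) with hr'
  have hU0 : U' ≠ 0 := (hU.monic.map _).ne_zero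
  have hgcd0 : EuclideanDomain.gcd U' r' ≠ 0 := fun h => hU0 (EuclideanDomain.gcd_eq_zero_iff.1 h).1
  set l := (EuclideanDomain.gcd U' r').leadingCoeff⁻¹ with hl
  have hDm := monic_mul_leadingCoeff_inv hgcd0
  set D := EuclideanDomain.gcd U' r' * C l with hD
  have hl0 : l ≠ 0 := inv_ne_zero (leadingCoeff_ne_zero.2 hgcd0)
  have hunit : IsUnit (C l : K[X]) := isUnit_C.2 hl0.isUnit
  have hDU : D ∣ U' := (hunit.mul_right_dvd).2 (EuclideanDomain.gcd_dvd_left _ _)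
  have hDr : D ∣ r' := (hunit.mul_right_dvd).2 (EuclideanDomain.gcd_dvd_right _ _)
  obtain ⟨P, hPm, hPD, hPd⟩ := exists_monic_lift_of_dvd hU.monic hDm hDU
  obtain ⟨g, α, β, hg, hα, hβ⟩ := exists_clear_denominators (R := entireAlg (Fin m → ℝ))
    (EuclideanDomain.gcdA U' r' * C l) (EuclideanDomain.gcdB U' r' * C l)
  have hrel : C g * P.map (algebraMap _ (entireAlg (Fin m → ℝ))) =
      U.map (algebraMap _ (entireAlg (Fin m → ℝ))) * α + r * β := by
    apply map_injective _ (IsFractionRing.injective (entireAlg (Fin m → ℝ)) K)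
    rw [Polynomial.map_mul, Polynomial.map_add, Polynomial.map_mul, Polynomial.map_mul, Polynomial.map_map,
      Polynomial.map_map, ← IsScalarTower.algebraMap_eq, hα, hβ, hPD, map_C, hD, EuclideanDomain.gcd_eq_gcd_ab]
    ring
  have hPV : ∀ x t, V x t = 0 → bivEval P x t = 0 := by
    intro x t h
    refine hV.bivEval_eq_zero_of_mul hU.monic hU.eq_zero hg (fun x t h => ?_) h
    have := congrArg (eval₂ (evalHom x) t) hrel
    rw [eval₂_mul, eval₂_add, eval₂_mul, eval₂_mul, eval₂_evalHom_map, eval₂_evalHom_map, eval₂_C,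
      hr x t h, hU.eq_zero x t h] at this
    simpa [evalHom_apply] using this
  have hle := hU.le P hPm hPV
  have heq : D = U' := by
    refine (eq_of_monic_of_dvd_of_natDegree_le hDm (hU.monic.map _) hDU ?_).symm
    rw [← hPd, (hU.monic).natDegree_map]
    exact hle
  exact heq ▸ hDr

end

section

open Polynomial Filter Topology
open scoped ContDiff

variable {m : ℕ} {V : (Fin m → ℝ) → ℝ → ℝ} {c : ℕ → (Fin m → ℝ) → ℝ}
  {U : (MvPolynomial (Fin m) ℝ)[X]}

theorem IsMinimalMonic.eq_zero_of_bivEval (hU : IsMinimalMonic V U) (hV : IsOscillating V)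
    (hc : IsEntireSeries V c) {x : Fin m → ℝ} {t : ℝ} (h : bivEval U x t = 0) : V x t = 0 := by
  obtain ⟨r, hr, hre⟩ := hc.exists_remainder hU.monic
  have hdvd := hU.dvd_map (K := FractionRing (entireAlg (Fin m → ℝ))) hV (r := r)
    fun x t h => (hre x t (hU.eq_zero x t h)).trans h
  have hmon := hU.monic.map (algebraMap _ (FractionRing (entireAlg (Fin m → ℝ))))
  have h0 : r.map (algebraMap _ (FractionRing (entireAlg (Fin m → ℝ)))) = 0 := by
    refine eq_zero_of_dvd_of_degree_lt hdvd ?_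
    rw [degree_eq_natDegree hmon.ne_zero, hU.monic.natDegree_map]
    exact degree_map_le.trans_lt hr
  have hr0 : r = 0 := (Polynomial.map_eq_zero_iff (IsFractionRing.injective _ _)).1 h0
  rw [← hre x t h, hr0, eval₂_zero]

instance : CharZero (entireAlg (Fin m → ℝ)) :=
  charZero_of_injective_algebraMap (algebraMap ℝ (entireAlg (Fin m → ℝ))).injective

theorem IsMinimalMonic.squarefree {K : Type*} [Field K] [Algebra (entireAlg (Fin m → ℝ)) K]
    [IsFractionRing (entireAlg (Fin m → ℝ)) K] [Algebra (MvPolynomial (Fin m) ℝ) K]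
    [IsScalarTower (MvPolynomial (Fin m) ℝ) (entireAlg (Fin m → ℝ)) K]
    (hU : IsMinimalMonic V U) : Squarefree (U.map (algebraMap _ K)) := by
  have hinj : Function.Injective (algebraMap (MvPolynomial (Fin m) ℝ) K) := by
    rw [IsScalarTower.algebraMap_eq _ (entireAlg (Fin m → ℝ)) K]
    exact (IsFractionRing.injective _ K).comp algebraMap_entireAlg_injective
  set U' := U.map (algebraMap _ K) with hU'
  have hmon : U'.Monic := hU.monic.map _
  intro D' hD'
  by_contra hunit
  have hD'0 : D' ≠ 0 := by
    rintro rfl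
    exact hmon.ne_zero (zero_dvd_iff.1 (by simpa using hD'))
  have hD := monic_mul_leadingCoeff_inv hD'0
  have hl : IsUnit (C D'.leadingCoeff⁻¹) :=
    isUnit_C.2 (inv_ne_zero (leadingCoeff_ne_zero.2 hD'0)).isUnit
  set D := D' * C D'.leadingCoeff⁻¹ with hDdef
  have hDpos : 0 < D.natDegree := by
    rw [Nat.pos_iff_ne_zero]
    intro h
    exact hunit (isUnit_of_mul_isUnit_left (y := C D'.leadingCoeff⁻¹)
      (by rw [← hDdef, hD.natDegree_eq_zero.1 h]; exact isUnit_one))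
  have hDD : D * D ∣ U' := by
    rw [hDdef, mul_mul_mul_comm]
    exact ((hl.mul hl).mul_right_dvd).2 hD'
  obtain ⟨E₁, hE₁⟩ := hDD
  rw [mul_assoc] at hE₁
  have hE : (D * E₁).Monic := hD.of_mul_monic_left (hE₁ ▸ hmon)
  have hE₁m : E₁.Monic := hD.of_mul_monic_left hE
  obtain ⟨P, hP, hPD, -⟩ := exists_monic_lift_of_dvd hU.monic hD (Dvd.intro _ hE₁.symm)
  obtain ⟨Q, hQ, hQE, hQd⟩ := exists_monic_lift_of_dvd hU.monic hE (Dvd.intro_left _ hE₁.symm)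
  obtain ⟨R, hR, hRE, -⟩ := exists_monic_lift_of_dvd hU.monic hE₁m
    ((Dvd.intro_left D rfl).trans (Dvd.intro_left _ hE₁.symm))
  have hUPQ : U = P * Q := map_injective _ hinj (by rw [Polynomial.map_mul, hPD, hQE, ← hE₁])
  have hQPR : Q = P * R := map_injective _ hinj (by rw [Polynomial.map_mul, hPD, hRE, hQE])
  have hQV : ∀ x t, V x t = 0 → bivEval Q x t = 0 := by
    intro x t h
    have h1 := hU.eq_zero x t h
    rw [hUPQ, bivEval, eval₂_mul] at h1
    rcases mul_eq_zero.1 h1 with h2 | h2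
    · rw [hQPR, bivEval, eval₂_mul, h2, zero_mul]
    · exact h2
  have h3 := hU.le Q hQ hQV
  have h4 : U'.natDegree = D.natDegree + (D * E₁).natDegree := by
    conv_lhs => rw [hE₁]
    exact hD.natDegree_mul hE
  rw [hU', hU.monic.natDegree_map, ← hQd] at h4
  omega

theorem IsMinimalMonic.exists_separating (hU : IsMinimalMonic V U) :
    ∃ δ : entireAlg (Fin m → ℝ), δ ≠ 0 ∧ ∀ x t, δ.1 x ≠ 0 → bivEval U x t = 0 →
      bivEval (derivative U) x t ≠ 0 := by
  obtain ⟨a, b, hab⟩ := PerfectField.separable_iff_squarefree.2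
    (hU.squarefree (K := FractionRing (entireAlg (Fin m → ℝ))))
  obtain ⟨g, α, β, hg, hα, hβ⟩ := exists_clear_denominators (R := entireAlg (Fin m → ℝ)) a b
  have hrel : α * U.map (algebraMap _ _) + β * (derivative U).map (algebraMap _ _) = C g := by
    apply map_injective _ (IsFractionRing.injective (entireAlg (Fin m → ℝ))
      (FractionRing (entireAlg (Fin m → ℝ))))
    rw [Polynomial.map_add, Polynomial.map_mul, Polynomial.map_mul, hα, hβ, Polynomial.map_map,
      Polynomial.map_map, ← IsScalarTower.algebraMap_eq, map_C, ← derivative_map, mul_assoc,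
      mul_assoc, ← mul_add, hab, mul_one]
  refine ⟨g, hg, fun x t hgx h h' => hgx ?_⟩
  have := congrArg (eval₂ (evalHom x) t) hrel
  rw [eval₂_add, eval₂_mul, eval₂_mul, eval₂_evalHom_map, eval₂_evalHom_map, h, h', eval₂_C] at this
  simpa [evalHom_apply] using this.symm

/-- At a simple zero, `U` and `V` change sign together. -/
theorem IsOscillating.not_sign_change (hV : IsOscillating V)
    (hVU : ∀ x t, V x t = 0 → bivEval U x t = 0) {x : Fin m → ℝ} {t : ℝ} (ht : V x t = 0)
    (hd : bivEval (derivative U) x t ≠ 0) :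
    ∀ᶠ ε in 𝓝[>] (0 : ℝ), ∀ s₁ ∈ Set.Ioo (t - ε) t, ∀ s₂ ∈ Set.Ioo t (t + ε),
      0 ≤ (bivEval U x s₁ * V x s₁) * (bivEval U x s₂ * V x s₂) := by
  set κ := bivEval (derivative U) x t with hκ
  have h1 : ∀ᶠ p in 𝓝 (x, t), 0 < κ * bivEval (derivative U) p.1 p.2 :=
    ((continuous_const.mul (continuous_bivEval (derivative U))).tendsto (x, t)).eventually
      (lt_mem_nhds (mul_self_pos.2 hd))
  obtain ⟨η, hη, hball⟩ := Metric.eventually_nhds_iff_ball.1 h1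
  have hmono : ∀ y ∈ ball x η, StrictMonoOn (fun s => κ * bivEval U y s) (ball t η) := by
    intro y hy
    have hder : ∀ s, HasDerivAt (fun s => κ * bivEval U y s)
        (κ * bivEval (derivative U) y s) s := fun s => (hasDerivAt_bivEval U y s).const_mul κ
    refine strictMonoOn_of_deriv_pos (convex_ball t η)
      (fun s _ => (hder s).continuousAt.continuousWithinAt) fun s hs => ?_
    rw [(hder s).deriv]
    refine hball (y, s) ?_
    rw [← ball_prod_same]
    exact ⟨hy, interior_subset hs⟩
  filter_upwards [Ioo_mem_nhdsGT hη] with ε hε s₁ hs₁ s₂ hs₂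
  have hs₁b : s₁ ∈ ball t η := by
    rw [Real.ball_eq_Ioo]; exact ⟨by linarith [hs₁.1, hε.2], by linarith [hs₁.2]⟩
  have hs₂b : s₂ ∈ ball t η := by
    rw [Real.ball_eq_Ioo]; exact ⟨by linarith [hs₂.1], by linarith [hs₂.2, hε.2]⟩
  have hU1 := hmono x (mem_ball_self hη) hs₁b (mem_ball_self hη) hs₁.2
  have hU2 := hmono x (mem_ball_self hη) (mem_ball_self hη) hs₂b hs₂.1
  simp only [hVU x t ht, mul_zero] at hU1 hU2
  have hUU : bivEval U x s₁ * bivEval U x s₂ < 0 := by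
    by_contra! h
    nlinarith [mul_neg_of_neg_of_pos hU1 hU2, mul_nonneg (mul_self_nonneg κ) h]
  by_contra! hlt
  have hVV : 0 < V x s₁ * V x s₂ := by
    by_contra! h
    nlinarith [mul_nonneg_of_nonpos_of_nonpos hUU.le h]
  have hV1 : V x s₁ ≠ 0 := left_ne_zero_of_mul hVV.ne'
  have h2 : ∀ᶠ y in 𝓝 x, (0 < V x s₁ * V y s₁ ∧ 0 < V x s₁ * V y s₂) ∧ y ∈ ball x η :=
    ((((continuous_const.mul (hV.continuous_left s₁)).tendsto x).eventually
      (lt_mem_nhds (mul_self_pos.2 hV1))).and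
      (((continuous_const.mul (hV.continuous_left s₂)).tendsto x).eventually
      (lt_mem_nhds hVV))).and (ball_mem_nhds x hη)
  have h3 : ∀ᶠ p : (Fin m → ℝ) × ℝ in 𝓝 (x, t),
      ((0 < V x s₁ * V p.1 s₁ ∧ 0 < V x s₁ * V p.1 s₂) ∧ p.1 ∈ ball x η) ∧
        p.2 ∈ Set.Ioo s₁ s₂ := by
    rw [nhds_prod_eq]
    exact h2.prod_mk (Ioo_mem_nhds hs₁.2 hs₂.1)
  obtain ⟨⟨y, s⟩, hneg, ⟨⟨hp1, hp2⟩, hy⟩, hs⟩ :=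
    ((hV.frequently_mul_neg ht hV1).and_eventually h3).exists
  dsimp only at hneg hp1 hp2 hy hs
  have hcont : Continuous fun r => V x s₁ * V y r := continuous_const.mul (hV.continuous_right y)
  obtain ⟨a, ha, ha0⟩ := exists_zero_of_mul_neg hcont (mul_neg_of_pos_of_neg hp1 hneg)
  obtain ⟨b, hb, hb0⟩ := exists_zero_of_mul_neg hcont (mul_neg_of_neg_of_pos hneg hp2)
  have ha0 := (mul_eq_zero.1 ha0).resolve_left hV1
  have hb0 := (mul_eq_zero.1 hb0).resolve_left hV1
  rw [Set.uIcc_of_le hs.1.le] at ha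
  rw [Set.uIcc_of_le hs.2.le] at hb
  have hsub : ∀ r ∈ Set.Icc s₁ s₂, r ∈ ball t η := fun r hr =>
    (convex_ball t η).ordConnected.out hs₁b hs₂b hr
  have hab : a = b := by
    refine (hmono y hy).injOn (hsub a ⟨ha.1, ha.2.trans hs.2.le⟩)
      (hsub b ⟨hs.1.le.trans hb.1, hb.2⟩) ?_
    simp only [hVU _ _ ha0, hVU _ _ hb0]
  have : a = s := le_antisymm ha.2 (hab ▸ hb.1)
  rw [← this, ha0, mul_zero] at hneg
  exact hneg.false

end

section

open Polynomial Filter Topology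
open scoped ContDiff

variable {m : ℕ} {V : (Fin m → ℝ) → ℝ → ℝ} {c : ℕ → (Fin m → ℝ) → ℝ}
  {U : (MvPolynomial (Fin m) ℝ)[X]}

theorem nonneg_of_no_sign_change {f : ℝ → ℝ} (hf : Continuous f)
    (hiso : ∀ t, ∀ᶠ s in 𝓝[≠] t, f s ≠ 0)
    (hsign : ∀ t, f t = 0 → ∀ᶠ ε in 𝓝[>] (0 : ℝ), ∀ s₁ ∈ Set.Ioo (t - ε) t,
      ∀ s₂ ∈ Set.Ioo t (t + ε), 0 ≤ f s₁ * f s₂)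
    {a b : ℝ} (hab : a < b) (hb : 0 < f b) : 0 ≤ f a := by
  by_contra! ha
  set S := {s | s ∈ Set.Icc a b ∧ f s < 0} with hS
  have hne : S.Nonempty := ⟨a, ⟨le_rfl, hab.le⟩, ha⟩
  have hbdd : BddAbove S := ⟨b, fun s hs => hs.1.2⟩
  set t := sSup S with ht
  have htb : t ≤ b := csSup_le hne fun s hs => hs.1.2
  have hcl : t ∈ closure S := csSup_mem_closure hne hbdd
  have hft : f t ≤ 0 :=
    closure_minimal (fun s (hs : s ∈ S) => hs.2.le) (isClosed_le hf continuous_const) hcl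
  have htb' : t < b := htb.lt_of_ne fun h => by rw [h] at hft; linarith
  have hat : a ≤ t := le_csSup hbdd ⟨⟨le_rfl, hab.le⟩, ha⟩
  have hright : ∀ s ∈ Set.Ioc t b, 0 ≤ f s := by
    intro s hs
    by_contra! h
    exact (le_csSup hbdd ⟨⟨hat.trans hs.1.le, hs.2⟩, h⟩).not_gt hs.1
  have hft' : 0 ≤ f t := by
    have hc : t ∈ closure (Set.Ioc t b) := by
      rw [closure_Ioc htb'.ne]; exact ⟨le_rfl, htb⟩
    exact closure_minimal hright (isClosed_le continuous_const hf) hc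
  have hft0 : f t = 0 := le_antisymm hft hft'
  have hright' : ∀ᶠ s in 𝓝[>] t, f s ≠ 0 :=
    nhdsWithin_mono t (fun s (hs : t < s) => hs.ne') (hiso t)
  obtain ⟨ε, hε, hε0⟩ := ((hsign t hft0).and self_mem_nhdsWithin).exists
  have hε0 : 0 < ε := hε0
  obtain ⟨s₁, hs₁, hs₁t⟩ := exists_lt_of_lt_csSup hne (show t - ε < sSup S by linarith)
  have hs₁lt : s₁ < t := (le_csSup hbdd hs₁).lt_of_ne fun h => by
    have := hs₁.2; rw [h, hft0] at this; exact this.false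
  obtain ⟨s₂, hs₂, hs₂t⟩ := (hright'.and (Ioo_mem_nhdsGT
    (lt_min (show t < t + ε by linarith) htb'))).exists
  have hs₂pos : 0 < f s₂ :=
    (hright s₂ ⟨hs₂t.1, (hs₂t.2.trans_le (min_le_right _ _)).le⟩).lt_of_ne hs₂.symm
  have := hε s₁ ⟨hs₁t, hs₁lt⟩ s₂ ⟨hs₂t.1, hs₂t.2.trans_le (min_le_left _ _)⟩
  nlinarith [mul_neg_of_neg_of_pos hs₁.2 hs₂pos]

theorem exists_continuous_root_bound (hU : U.Monic) :
    ∃ b : (Fin m → ℝ) → ℝ, Continuous b ∧ ∀ x t, b x ≤ t → bivEval U x t ≠ 0 := by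
  refine ⟨fun x => 2 + ∑ i ∈ Finset.range U.natDegree, ‖MvPolynomial.eval x (U.coeff i)‖, ?_, ?_⟩
  · exact continuous_const.add (continuous_finsetSum _ fun i _ =>
      (MvPolynomial.continuous_eval _).norm)
  · intro x t ht h
    rw [bivEval, eval₂_eq_sum_range, Finset.sum_range_succ, coeff_natDegree, hU.leadingCoeff,
      map_one, one_mul, add_comm] at h
    have := norm_le_of_homogeneous_root U.natDegree (fun i => MvPolynomial.eval x (U.coeff i)) t 1
      (by simpa using h)
    rw [norm_one, mul_one, Real.norm_eq_abs] at this
    linarith [le_abs_self t]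

theorem IsOscillating.mul_nonneg (hV : IsOscillating V) (hU : U.Monic)
    (hVU : ∀ x t, V x t = 0 ↔ bivEval U x t = 0) {δ : entireAlg (Fin m → ℝ)} (hδ : δ ≠ 0)
    (hsep : ∀ x t, δ.1 x ≠ 0 → bivEval U x t = 0 → bivEval (derivative U) x t ≠ 0)
    {b : (Fin m → ℝ) → ℝ} (hb : Continuous b) (hbU : ∀ x t, b x ≤ t → bivEval U x t ≠ 0)
    (h0 : 0 < bivEval U 0 (b 0) * V 0 (b 0)) (x : Fin m → ℝ) (t : ℝ) :
    0 ≤ bivEval U x t * V x t := by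
  have hcont : Continuous fun p : (Fin m → ℝ) × ℝ => bivEval U p.1 p.2 * V p.1 p.2 :=
    (continuous_bivEval U).mul hV.continuous
  have hzero : ∀ x t, bivEval U x t * V x t = 0 ↔ bivEval U x t = 0 := fun x t =>
    ⟨fun h => (mul_eq_zero.1 h).elim id (hVU x t).1, fun h => by rw [h, zero_mul]⟩
  have htop : ∀ x, 0 < bivEval U x (b x) * V x (b x) := by
    intro x
    by_contra! h
    have hc : Continuous fun x => bivEval U x (b x) * V x (b x) :=
      hcont.comp (continuous_id.prodMk hb)
    obtain ⟨y, hy⟩ := mem_range_of_exists_le_of_exists_ge hc ⟨x, h⟩ ⟨0, h0.le⟩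
    exact hbU y _ le_rfl ((hzero _ _).1 hy)
  have hgen : ∀ x, δ.1 x ≠ 0 → ∀ t, 0 ≤ bivEval U x t * V x t := by
    intro x hx t
    have hcx : Continuous fun t => bivEval U x t * V x t := hcont.comp (Continuous.prodMk_right x)
    rcases lt_or_ge t (b x) with h | h
    · refine nonneg_of_no_sign_change (f := fun t => bivEval U x t * V x t) hcx (fun t => ?_)
        (fun t ht => ?_) h (htop x)
      · filter_upwards [eventually_bivEval_ne_zero hU x t] with s hs h
        exact hs ((hzero _ _).1 h)
      · have hUt := (hzero _ _).1 ht
        exact hV.not_sign_change (fun x t => (hVU x t).1) ((hVU x t).2 hUt) (hsep x t hx hUt)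
    · by_contra! hneg
      obtain ⟨s, hs, hs0⟩ := exists_zero_of_mul_neg hcx (mul_neg_of_pos_of_neg (htop x) hneg)
      rw [Set.uIcc_of_le h] at hs
      exact hbU x s hs.1 ((hzero _ _).1 hs0)
  by_contra! hneg
  have hev : ∀ᶠ y in 𝓝 x, bivEval U y t * V y t < 0 :=
    ((hcont.comp (Continuous.prodMk_left t)).tendsto x).eventually (gt_mem_nhds hneg)
  obtain ⟨y, hy, hneg⟩ := ((frequently_ne_zero_of_mem_entireAlg hδ x).and_eventually hev).exists
  exact (hgen y hy t).not_gt hneg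

/-- An oscillating entire series whose zeros lie among those of a monic polynomial has a polynomial
multiple of constant sign. -/
theorem IsOscillating.exists_monic_mul_nonneg (hV : IsOscillating V) (hc : IsEntireSeries V c)
    {U₀ : (MvPolynomial (Fin m) ℝ)[X]} (hU₀ : U₀.Monic)
    (h : ∀ x t, V x t = 0 → bivEval U₀ x t = 0) :
    ∃ U : (MvPolynomial (Fin m) ℝ)[X], (∃ x t, bivEval U x t ≠ 0) ∧
      ∀ x t, 0 ≤ bivEval U x t * V x t := by
  obtain ⟨U, hU⟩ := exists_isMinimalMonic hU₀ h
  obtain ⟨δ, hδ, hsep⟩ := hU.exists_separating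
  obtain ⟨b, hb, hbU⟩ := exists_continuous_root_bound hU.monic
  have hVU : ∀ x t, V x t = 0 ↔ bivEval U x t = 0 := fun x t =>
    ⟨hU.eq_zero x t, hU.eq_zero_of_bivEval hV hc⟩
  have hne : bivEval U 0 (b 0) * V 0 (b 0) ≠ 0 :=
    mul_ne_zero (hbU 0 _ le_rfl) fun h => hbU 0 _ le_rfl ((hVU _ _).1 h)
  rcases hne.lt_or_gt with h0 | h0
  · refine ⟨-U, ⟨0, b 0, by simpa [bivEval] using hbU 0 _ le_rfl⟩, fun x t => ?_⟩
    have := hV.fun_neg.mul_nonneg hU.monic (fun x t => neg_eq_zero.trans (hVU x t)) hδ hsep hb hbU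
      (by rw [mul_neg]; linarith) x t
    simpa [bivEval] using this
  · exact ⟨U, ⟨0, b 0, hbU 0 _ le_rfl⟩, hV.mul_nonneg hU.monic hVU hδ hsep hb hbU h0⟩

end

section

open Polynomial Filter Topology
open scoped ContDiff

variable {m n : ℕ}

/-- The substitution `y = (0, x) + t e`, with `t` as the polynomial variable. -/
def shearHom (e : Fin (m + 1) → ℝ) :
    MvPolynomial (Fin (m + 1)) ℝ →ₐ[ℝ] (MvPolynomial (Fin m) ℝ)[X] :=
  MvPolynomial.aeval fun i =>
    C ((Fin.cons 0 MvPolynomial.X : Fin (m + 1) → MvPolynomial (Fin m) ℝ) i) +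
      C (MvPolynomial.C (e i)) * X

theorem bivEval_shearHom (e : Fin (m + 1) → ℝ) (p : MvPolynomial (Fin (m + 1)) ℝ) (x : Fin m → ℝ)
    (t : ℝ) : bivEval (shearHom e p) x t =
      MvPolynomial.eval (fun i => (Fin.cons 0 x : Fin (m + 1) → ℝ) i + t * e i) p := by
  induction p using MvPolynomial.induction_on with
  | C r => simp [shearHom, bivEval, Polynomial.algebraMap_apply, MvPolynomial.algebraMap_eq]
  | add p q hp hq => rw [map_add, map_add, ← hp, ← hq, bivEval, eval₂_add]
  | mul_X p i hp =>
    rw [map_mul, map_mul, ← hp, bivEval, eval₂_mul]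
    congr 1
    refine Fin.cases ?_ (fun j => ?_) i <;> simp [shearHom] <;> ring

theorem shearHom_monomial (e : Fin (m + 1) → ℝ) (s : Fin (m + 1) →₀ ℕ) (a : ℝ) :
    (shearHom e (MvPolynomial.monomial s a)).natDegree ≤ s.degree ∧
      (shearHom e (MvPolynomial.monomial s a)).coeff s.degree =
        MvPolynomial.C (MvPolynomial.eval e (MvPolynomial.monomial s a)) := by
  have hX : ∀ i, (shearHom e (MvPolynomial.X i)).natDegree ≤ 1 ∧
      (shearHom e (MvPolynomial.X i)).coeff 1 = MvPolynomial.C (e i) := by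
    intro i
    rw [shearHom, MvPolynomial.aeval_X]
    refine ⟨by compute_degree, by simp [coeff_C]⟩
  have hpow : ∀ i k, (shearHom e (MvPolynomial.X i) ^ k).natDegree ≤ k ∧
      (shearHom e (MvPolynomial.X i) ^ k).coeff k = MvPolynomial.C (e i) ^ k := by
    intro i k
    refine ⟨(natDegree_pow_le_of_le k (hX i).1).trans (by simp), ?_⟩
    rw [← (hX i).2, ← coeff_pow_of_natDegree_le (hX i).1, mul_one]
  have hprod : ∀ S : Finset (Fin (m + 1)),
      (∏ i ∈ S, shearHom e (MvPolynomial.X i) ^ s i).natDegree ≤ ∑ i ∈ S, s i ∧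
      (∏ i ∈ S, shearHom e (MvPolynomial.X i) ^ s i).coeff (∑ i ∈ S, s i) =
        ∏ i ∈ S, MvPolynomial.C (e i) ^ s i := by
    intro S
    induction S using Finset.induction_on with
    | empty => simp
    | insert i S hi ih =>
      rw [Finset.prod_insert hi, Finset.sum_insert hi, Finset.prod_insert hi]
      refine ⟨natDegree_mul_le.trans (add_le_add (hpow i _).1 ih.1), ?_⟩
      rw [coeff_mul_add_eq_of_natDegree_le (hpow i _).1 ih.1, (hpow i _).2, ih.2]
  obtain ⟨h1, h2⟩ := hprod Finset.univ
  rw [← Finsupp.degree_eq_sum] at h1 h2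
  have h3 : shearHom e (MvPolynomial.monomial s a) =
      C (MvPolynomial.C a) * ∏ i, shearHom e (MvPolynomial.X i) ^ s i := by
    rw [MvPolynomial.monomial_eq, map_mul, Finsupp.prod_fintype _ _ (fun i => pow_zero _), map_prod]
    congr 1
    · simp [shearHom, Polynomial.algebraMap_apply, MvPolynomial.algebraMap_eq]
    · simp only [map_pow]
  rw [h3]
  refine ⟨(natDegree_C_mul_le _ _).trans h1, ?_⟩
  rw [coeff_C_mul, h2, MvPolynomial.eval_monomial, Finsupp.prod_fintype _ _ (fun i => pow_zero _)]
  simp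

theorem shearHom_natDegree_le (e : Fin (m + 1) → ℝ) (p : MvPolynomial (Fin (m + 1)) ℝ) :
    (shearHom e p).natDegree ≤ p.totalDegree := by
  conv_lhs => rw [← MvPolynomial.support_sum_monomial_coeff p, map_sum]
  exact natDegree_sum_le_of_forall_le _ _ fun s hs =>
    (shearHom_monomial e s _).1.trans (MvPolynomial.le_totalDegree hs)

theorem shearHom_coeff_totalDegree (e : Fin (m + 1) → ℝ) (p : MvPolynomial (Fin (m + 1)) ℝ) :
    (shearHom e p).coeff p.totalDegree =
      MvPolynomial.C (MvPolynomial.eval e (p.homogeneousComponent p.totalDegree)) := by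
  conv_lhs => rw [← MvPolynomial.support_sum_monomial_coeff p, map_sum]
  rw [MvPolynomial.support_sum_monomial_coeff, finsetSum_coeff,
    MvPolynomial.homogeneousComponent_apply, map_sum, map_sum, Finset.sum_filter]
  refine Finset.sum_congr rfl fun s hs => ?_
  split_ifs with h
  · rw [← h, (shearHom_monomial e s _).2]
  · refine coeff_eq_zero_of_natDegree_lt ((shearHom_monomial e s _).1.trans_lt ?_)
    exact lt_of_le_of_ne (MvPolynomial.le_totalDegree hs) h

theorem homogeneousComponent_totalDegree_ne_zero {p : MvPolynomial (Fin n) ℝ} (hp : p ≠ 0) :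
    p.homogeneousComponent p.totalDegree ≠ 0 := by
  intro h
  obtain ⟨s, hs, hsd⟩ := Finset.exists_mem_eq_sup p.support (MvPolynomial.support_nonempty.2 hp)
    fun s => s.sum fun _ e => e
  have := congrArg (MvPolynomial.coeff s) h
  rw [MvPolynomial.coeff_homogeneousComponent, if_pos, MvPolynomial.coeff_zero] at this
  · exact MvPolynomial.mem_support_iff.1 hs this
  · exact hsd.symm

/-- After a linear change of coordinates a nonzero polynomial becomes monic in the last variable. -/
theorem exists_shearHom_monic {p : MvPolynomial (Fin (m + 1)) ℝ} (hp : p ≠ 0) :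
    ∃ (e : Fin (m + 1) → ℝ) (a : ℝ), e 0 ≠ 0 ∧ (C (MvPolynomial.C a) * shearHom e p).Monic := by
  have h := mul_ne_zero (homogeneousComponent_totalDegree_ne_zero hp)
    (MvPolynomial.X_ne_zero (R := ℝ) (0 : Fin (m + 1)))
  obtain ⟨e, he⟩ : ∃ e, MvPolynomial.eval e
      (p.homogeneousComponent p.totalDegree * MvPolynomial.X 0) ≠ 0 := by
    by_contra! h'
    exact h (MvPolynomial.funext fun e => by rw [h' e, map_zero])
  rw [map_mul, MvPolynomial.eval_X] at he
  refine ⟨e, (MvPolynomial.eval e (p.homogeneousComponent p.totalDegree))⁻¹,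
    right_ne_zero_of_mul he, monic_of_natDegree_le_of_coeff_eq_one p.totalDegree ?_ ?_⟩
  · exact (natDegree_C_mul_le _ _).trans (shearHom_natDegree_le e p)
  · rw [coeff_C_mul, shearHom_coeff_totalDegree, ← map_mul,
      inv_mul_cancel₀ (left_ne_zero_of_mul he), map_one]

end

section

open Polynomial Filter Topology
open scoped ContDiff

variable {m n : ℕ} {v : Euc (m + 1) → ℝ} {A : Matrix (Fin (m + 1)) (Fin (m + 1)) ℝ}
  {ρ : Euc (m + 1) → ℝ}

/-- The inclusion of the coordinate hyperplane `y 0 = 0`. -/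
def hyperplaneIncl (m : ℕ) : (Fin m → ℝ) →L[ℝ] Euc (m + 1) :=
  LinearMap.toContinuousLinearMap
    { toFun := fun x => WithLp.toLp 2 (Fin.cons 0 x)
      map_add' := fun x y => by
        ext i
        refine Fin.cases ?_ (fun j => ?_) i <;> simp
      map_smul' := fun c x => by
        ext i
        refine Fin.cases ?_ (fun j => ?_) i <;> simp }

@[simp] theorem hyperplaneIncl_zero (x : Fin m → ℝ) : hyperplaneIncl m x 0 = 0 := rfl

@[simp] theorem hyperplaneIncl_succ (x : Fin m → ℝ) (j : Fin m) :
    hyperplaneIncl m x j.succ = x j := rfl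

/-- The linear coordinates `(x, t)` in which `y = (0, x) + t e`. -/
def shearCoord (e : Euc (m + 1)) (y : Euc (m + 1)) : (Fin m → ℝ) × ℝ :=
  (fun j => y j.succ - y 0 / e 0 * e j.succ, y 0 / e 0)

theorem continuous_shearCoord (e : Euc (m + 1)) : Continuous (shearCoord e) := by
  unfold shearCoord
  fun_prop

theorem shearCoord_apply {e : Euc (m + 1)} (he : e 0 ≠ 0) (x : Fin m → ℝ) (t : ℝ) :
    shearCoord e (hyperplaneIncl m x + t • e) = (x, t) := by
  refine Prod.ext (funext fun j => ?_) ?_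
  · simp [shearCoord, he]
  · simp [shearCoord, he]

theorem shearCoord_left_inv {e : Euc (m + 1)} (he : e 0 ≠ 0) (y : Euc (m + 1)) :
    hyperplaneIncl m (shearCoord e y).1 + (shearCoord e y).2 • e = y := by
  ext i
  refine Fin.cases ?_ (fun j => ?_) i
  · simp [shearCoord, he]
  · simp [shearCoord]

theorem IsGauge.isOscillating (hρ : IsGauge A ρ) (hv : ContDiff ℝ ∞ v)
    (hLv : ellipticOp A v = 0) (hne : v ≠ 0) {e : Euc (m + 1)} (he : e 0 ≠ 0) :
    IsOscillating fun x t => v (hyperplaneIncl m x + t • e) := by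
  have key : ∀ x t, Tendsto (shearCoord e) (𝓝 (hyperplaneIncl m x + t • e)) (𝓝 (x, t)) := by
    intro x t
    have := (continuous_shearCoord e).tendsto (hyperplaneIncl m x + t • e)
    rwa [shearCoord_apply he] at this
  refine ⟨hv.continuous.comp (by fun_prop), fun x t h => ?_, fun x t h => ?_⟩
  · refine (key x t).frequently ((hρ.exists_neg hv hLv hne h).mono fun y hy => ?_)
    rwa [shearCoord_left_inv he]
  · refine (key x t).frequently ((hρ.exists_pos hv hLv hne h).mono fun y hy => ?_)
    rwa [shearCoord_left_inv he]

theorem IsGauge.isEntireSeries (hρ : IsGauge A ρ) (hv : ContDiff ℝ ∞ v)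
    (hLv : ellipticOp A v = 0) (e : Euc (m + 1)) :
    IsEntireSeries (fun x t => v (hyperplaneIncl m x + t • e))
      fun k x => (dirDeriv e)^[k] v (hyperplaneIncl m x) / k.factorial where
  hasSum x t := by
    have := hρ.hasSum_taylor hv hLv (hyperplaneIncl m x) (t • e)
    simp only [dirDeriv_iterate_smul hv] at this
    convert this using 2
    ring
  continuous k := ((hv.dirDeriv_iterate e k).continuous.comp (by fun_prop)).div_const _
  bound S r hr := by
    obtain ⟨C, hC, h⟩ :=
      hρ.exists_dirDeriv_iterate_bound hv hLv (‖hyperplaneIncl m‖ * S) ‖e‖ hr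
    refine ⟨C, hC, fun k x hx => ?_⟩
    have h1 := h e e le_rfl le_rfl (hyperplaneIncl m x)
      ((ContinuousLinearMap.le_opNorm _ _).trans (by gcongr)) 0 k
    rw [abs_div, Nat.abs_cast, div_le_iff₀ (by positivity)]
    simp only [Function.iterate_zero, id, zero_add] at h1
    linarith
  entire x d := by
    obtain ⟨F, h1, h2, h3⟩ := hρ.exists_entire_coeff hv hLv (hyperplaneIncl m x) e
      (hyperplaneIncl m d)
    exact ⟨F, h1, fun k s => by rw [h2, map_add, map_smul], h3⟩

/-- A polynomial in the coordinates `shearCoord e`, as a polynomial in the standard ones. -/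
theorem exists_eval_eq_bivEval_shearCoord (e : Euc (m + 1)) (U : (MvPolynomial (Fin m) ℝ)[X]) :
    ∃ P : MvPolynomial (Fin (m + 1)) ℝ, ∀ y : Euc (m + 1),
      MvPolynomial.eval (fun i => y i) P = bivEval U (shearCoord e y).1 (shearCoord e y).2 := by
  refine ⟨U.eval₂ (MvPolynomial.aeval fun j : Fin m =>
    MvPolynomial.X j.succ - MvPolynomial.C (e j.succ / e 0) * MvPolynomial.X 0 :
      MvPolynomial (Fin m) ℝ →ₐ[ℝ] MvPolynomial (Fin (m + 1)) ℝ).toRingHom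
    (MvPolynomial.C (1 / e 0) * MvPolynomial.X 0), fun y => ?_⟩
  rw [hom_eval₂]
  unfold bivEval
  congr 1
  · refine MvPolynomial.ringHom_ext (fun r => by simp [MvPolynomial.algebraMap_eq]) fun j => ?_
    simp [shearCoord]
    ring
  · simp [shearCoord]
    ring

/-- A nontrivial polynomial vanishing on the zero set of `v` yields a nontrivial polynomial with
the sign of `v`. -/
theorem IsGauge.exists_eval_mul_nonneg (hρ : IsGauge A ρ) (hv : ContDiff ℝ ∞ v)
    (hLv : ellipticOp A v = 0) (hne : v ≠ 0) {p : MvPolynomial (Fin (m + 1)) ℝ} (hp : p ≠ 0)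
    (h : ∀ y, v y = 0 → MvPolynomial.eval (fun i => y i) p = 0) :
    ∃ P : MvPolynomial (Fin (m + 1)) ℝ,
      (∃ y : Euc (m + 1), MvPolynomial.eval (fun i => y i) P ≠ 0) ∧
      ∀ y : Euc (m + 1), 0 ≤ MvPolynomial.eval (fun i => y i) P * v y := by
  obtain ⟨e, a, he, hmonic⟩ := exists_shearHom_monic hp
  set e' : Euc (m + 1) := WithLp.toLp 2 e with he'
  have he0 : e' 0 ≠ 0 := he
  obtain ⟨U, ⟨x, t, hxt⟩, hU⟩ := (hρ.isOscillating hv hLv hne he0).exists_monic_mul_nonneg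
    (hρ.isEntireSeries hv hLv e') hmonic fun x t hxt => by
      have h1 := bivEval_shearHom e p x t
      unfold bivEval at h1 ⊢
      rw [eval₂_mul, h1]
      refine mul_eq_zero_of_right _ (Eq.trans ?_ (h _ hxt))
      rfl
  obtain ⟨P, hP⟩ := exists_eval_eq_bivEval_shearCoord e' U
  refine ⟨P, ⟨hyperplaneIncl m x + t • e', ?_⟩, fun y => ?_⟩
  · rw [hP, shearCoord_apply he0]
    exact hxt
  · have := hU (shearCoord e' y).1 (shearCoord e' y).2
    rwa [← hP, shearCoord_left_inv he0] at this

theorem IsGauge.exists_mul_eq_eval (hρ : IsGauge A ρ) (hv : ContDiff ℝ ∞ v)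
    (hLv : ellipticOp A v = 0) (hne : v ≠ 0) {p : MvPolynomial (Fin (m + 1)) ℝ} (hp : p ≠ 0)
    (h : ∀ y, v y = 0 → MvPolynomial.eval (fun i => y i) p = 0) :
    ∃ P T : MvPolynomial (Fin (m + 1)) ℝ,
      (∃ y : Euc (m + 1), MvPolynomial.eval (fun i => y i) P ≠ 0) ∧
      ∀ y : Euc (m + 1), MvPolynomial.eval (fun i => y i) P * v y =
        MvPolynomial.eval (fun i => y i) T := by
  obtain ⟨P, hP0, hP⟩ := hρ.exists_eval_mul_nonneg hv hLv hne hp h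
  obtain ⟨l, hl⟩ := (isPolyHarm_one hv hLv).exists_eval_mul P
  obtain ⟨T, hT⟩ := hl.exists_mvPolynomial hρ hP
  exact ⟨P, T, hP0, hT⟩

end

section

open Polynomial Filter Topology
open scoped ContDiff

variable {m n : ℕ}

theorem exists_lineEval_eq_eval (x d : Fin m → ℝ) (a : MvPolynomial (Fin m) ℝ) :
    ∃ q : ℂ[X], ∀ z, lineEval x d z a = q.eval z := by
  refine ⟨MvPolynomial.eval₂Hom (C.comp Complex.ofRealHom) (fun k => C (x k : ℂ) + X * C (d k : ℂ))
    a, fun z => ?_⟩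
  rw [← coe_evalRingHom, ← RingHom.comp_apply]
  congr 1
  refine MvPolynomial.ringHom_ext (fun r => by simp [lineEval]) fun j => ?_
  simp [lineEval, mul_comm z]

theorem exists_le_norm_eval {q : ℂ[X]} (hq : q ≠ 0) :
    ∃ c > 0, ∃ R : ℝ, ∀ z : ℂ, R ≤ ‖z‖ → c ≤ ‖q.eval z‖ := by
  rcases lt_or_ge 0 q.degree with hd | hd
  · have h := (q.tendsto_norm_atTop hd tendsto_norm_cobounded_atTop).eventually_ge_atTop 1
    obtain ⟨R, -, hR⟩ := (hasBasis_cobounded_norm (E := ℂ)).eventually_iff.1 h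
    exact ⟨1, one_pos, R, fun z hz => hR hz⟩
  · rw [eq_C_of_degree_le_zero hd] at hq ⊢
    refine ⟨‖q.coeff 0‖, norm_pos_iff.2 fun h => hq (by simp [h]), 0, fun z _ => by simp⟩

/-- An entire quotient of polynomials is polynomial on lines, with control of the degree. -/
theorem exists_polynomial_line {f : (Fin m → ℝ) → ℝ} (hf : f ∈ entireAlg (Fin m → ℝ))
    {P T : MvPolynomial (Fin m) ℝ} (h : ∀ x, MvPolynomial.eval x P * f x = MvPolynomial.eval x T) :
    ∃ N : ℕ, ∀ x d, MvPolynomial.eval x P ≠ 0 →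
      ∃ q : ℝ[X], q.natDegree ≤ N ∧ ∀ t : ℝ, f (x + t • d) = q.eval t := by
  obtain ⟨N, hN⟩ := exists_norm_lineEval_le T
  refine ⟨N, fun x d hx => ?_⟩
  obtain ⟨F, hF, hFf⟩ := hf.2 x d
  obtain ⟨C, hC, hCT⟩ := hN x d
  obtain ⟨p, hp⟩ := exists_lineEval_eq_eval x d P
  have hp0 : p ≠ 0 := by
    rintro rfl
    have h1 := hp (0 : ℝ)
    rw [lineEval_ofReal] at h1
    simp at h1
    exact hx h1
  have hmul : (fun z => lineEval x d z P * F z) = fun z => lineEval x d z T :=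
    eq_of_eventually_ofReal_eq ((differentiable_lineEval x d P).mul hF) (differentiable_lineEval x d T)
      (Eventually.of_forall fun s => by
        rw [lineEval_ofReal, lineEval_ofReal, hFf, ← h, Complex.ofReal_mul])
  obtain ⟨c, hc, R, hR⟩ := exists_le_norm_eval hp0
  obtain ⟨B, hB⟩ := (isCompact_closedBall (0 : ℂ) R).exists_bound_of_continuousOn
    hF.continuous.continuousOn
  have hb : ∀ z, ‖F z‖ ≤ (C / c + |B|) * (1 + ‖z‖) ^ N * ‖(1 : ℂ)‖ := by
    intro z
    have h1 : (1 : ℝ) ≤ (1 + ‖z‖) ^ N := one_le_pow₀ (by linarith [norm_nonneg z])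
    rw [norm_one, mul_one, add_mul]
    rcases le_total R ‖z‖ with hz | hz
    · have h2 := congrArg norm (congrFun hmul z)
      simp only [norm_mul] at h2
      have h3 : ‖F z‖ * c ≤ C * (1 + ‖z‖) ^ N := by
        rw [mul_comm]
        exact (mul_le_mul_of_nonneg_right (hp z ▸ hR z hz) (norm_nonneg _)).trans
          (h2.trans_le (hCT z))
      have h4 : ‖F z‖ ≤ C / c * (1 + ‖z‖) ^ N := by
        rw [div_mul_eq_mul_div, le_div_iff₀ hc]
        exact h3
      nlinarith [abs_nonneg B]
    · have h2 := hB z (by simpa using hz)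
      have h3 : 0 ≤ C / c * (1 + ‖z‖) ^ N := by positivity
      nlinarith [abs_nonneg B, le_abs_self B]
  obtain ⟨q, hq, hqe⟩ := exists_real_polynomial_mul_eq (g := fun _ => 1) (G := fun _ => 1)
    (s₀ := 0) hF (differentiable_const _) hFf (by simp) one_ne_zero hb
  exact ⟨q, hq, fun t => by simpa using hqe t⟩

theorem exists_mvPolynomial_of_mul_eq {f : (Fin m → ℝ) → ℝ} (hf : f ∈ entireAlg (Fin m → ℝ))
    {P T : MvPolynomial (Fin m) ℝ} (h : ∀ x, MvPolynomial.eval x P * f x = MvPolynomial.eval x T)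
    {y : Fin m → ℝ} (hy : MvPolynomial.eval y P ≠ 0) :
    ∃ Q : MvPolynomial (Fin m) ℝ, ∀ x, f x = MvPolynomial.eval x Q := by
  obtain ⟨N, hN⟩ := exists_polynomial_line hf h
  obtain ⟨ε, hε, hball⟩ := Metric.eventually_nhds_iff_ball.1
    (((MvPolynomial.continuous_eval P).tendsto y).eventually_ne hy)
  have hbox : ∀ x : Fin m → ℝ, (∀ i, x i ∈ ball (y i) ε) → x ∈ ball y ε := fun x hx =>
    mem_ball.2 ((dist_pi_lt_iff hε).2 hx)
  obtain ⟨Q, hQ⟩ := exists_mvPolynomial_of_lines (N := N) (f := fun x : Euc m => f fun i => x i)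
    (fun i => ball (y i) ε)
    (fun i => infinite_of_mem_nhds (y i) (ball_mem_nhds _ hε))
    fun x hx i => by
      obtain ⟨q, hq, hqe⟩ := hN (fun i => x i) (Pi.single i 1) (hball _ (hbox _ hx))
      refine ⟨q, hq, fun t => ?_⟩
      rw [← hqe]
      congr 1
  refine ⟨Q, fun x => ?_⟩
  have hfQ : (⟨f, hf⟩ : entireAlg (Fin m → ℝ)) = polyHom m Q := by
    refine entireAlg_ext_of_eventuallyEq (x := y) ?_
    filter_upwards [ball_mem_nhds y hε] with z hz
    exact hQ (WithLp.toLp 2 z) ((dist_pi_lt_iff hε).1 (mem_ball.1 hz))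
  exact congrFun (congrArg Subtype.val hfQ) x

theorem exists_mvPolynomial_of_zero_subset {A : Matrix (Fin n) (Fin n) ℝ} (hA : A.PosDef)
    (hn : n ≠ 0) {v : Euc n → ℝ} (hv : ContDiff ℝ ∞ v) (hLv : ellipticOp A v = 0) (hne : v ≠ 0)
    {p : MvPolynomial (Fin n) ℝ} (hp : p ≠ 0)
    (h : ∀ y, v y = 0 → MvPolynomial.eval (fun i => y i) p = 0) :
    ∃ Q : MvPolynomial (Fin n) ℝ, ∀ y, v y = MvPolynomial.eval (fun i => y i) Q := by
  obtain ⟨m, rfl⟩ := Nat.exists_eq_succ_of_ne_zero hn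
  obtain ⟨ρ, hρ⟩ := exists_isGauge hA
  obtain ⟨P, T, ⟨y, hy⟩, hPT⟩ := hρ.exists_mul_eq_eval hv hLv hne hp h
  have hmem := hρ.mem_entireAlg hv hLv
  have hf : (fun x : Fin (m + 1) → ℝ => v (WithLp.toLp 2 x)) ∈ entireAlg (Fin (m + 1) → ℝ) :=
    ⟨hv.continuous.comp (PiLp.continuous_toLp 2 _), fun x d =>
      hmem.2 (WithLp.toLp 2 x) (WithLp.toLp 2 d)⟩
  obtain ⟨Q, hQ⟩ := exists_mvPolynomial_of_mul_eq hf (fun x => hPT (WithLp.toLp 2 x)) hy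
  exact ⟨Q, fun y => hQ fun i => y i⟩

end

/-- Corollary 1.13 of the paper (nodal sets comparison): if `Z(v) ⊆ Z(u)` and `u` is a
polynomial solving a constant-coefficient elliptic equation, then `v` is also a polynomial. -/
theorem stmt_8 (n : ℕ) (hn : 2 ≤ n) (A Abar : Matrix (Fin n) (Fin n) ℝ)
    (hA : A.PosDef) (hAbar : Abar.PosDef)
    (u v : EuclideanSpace ℝ (Fin n) → ℝ)
    (hu : ContDiff ℝ (⊤ : ℕ∞) u) (hv : ContDiff ℝ (⊤ : ℕ∞) v)
    (hsolu : ∀ x : EuclideanSpace ℝ (Fin n), ∑ i, ∑ j, A i j * pd i (pd j u) x = 0)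
    (hsolv : ∀ x : EuclideanSpace ℝ (Fin n), ∑ i, ∑ j, Abar i j * pd i (pd j v) x = 0)
    (hvne : ∃ x, v x ≠ 0)
    (hzsub : {x | v x = 0} ⊆ {x | u x = 0})
    (hupoly : ∃ p : MvPolynomial (Fin n) ℝ,
      ∀ x : EuclideanSpace ℝ (Fin n), u x = MvPolynomial.eval (fun i => x i) p)
    (hune : ∃ x, u x ≠ 0) :
    ∃ q : MvPolynomial (Fin n) ℝ,
      ∀ x : EuclideanSpace ℝ (Fin n), v x = MvPolynomial.eval (fun i => x i) q := by
  obtain ⟨p, hp⟩ := hupoly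
  obtain ⟨x, hx⟩ := hune
  refine exists_mvPolynomial_of_zero_subset hAbar (by omega) hv (funext hsolv) ?_ (p := p) ?_ ?_
  · rintro rfl
    simp at hvne
  · rintro rfl
    simp [hp] at hx
  · exact fun y hy => (hp y).symm.trans (hzsub hy)
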